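/- arXiv:2410.04181 — 16 statements merged into one kernel-verified Lean document; each statement's English description precedes it below -/
import Mathlib

section
/- Let R be a φ-ring (a commutative ring whose nilradical Nil(R) is a divided prime ideal). Then R is a φ-Prüfer ring (equivalently, R/Nil(R) is a Prüfer domain, i.e., every nonzero finitely generated ideal of the domain R/Nil(R) is invertible as a fractional ideal) if and only if the lattice formed by the nonnil ideals of R is distributive, i.e., I ∩ (J + K) = (I ∩ J) + (I ∩ K) for any three nonnil ideals I, J, K of R. -/
/-- A φ-ring: a commutative ring whose nilradical is a divided prime ideal
(prime and comparable under inclusion with every ideal). -/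
def IsPhiRing (R : Type*) [CommRing R] : Prop :=
  (nilradical R).IsPrime ∧ ∀ I : Ideal R, I ≤ nilradical R ∨ nilradical R ≤ I

/-- A φ-Prüfer ring: `R ⧸ nilradical R` is a Prüfer domain, i.e., every nonzero
finitely generated ideal of it is invertible as a fractional ideal. -/
def IsPhiPrufer (R : Type*) [CommRing R] : Prop :=
  ∀ I : Ideal (R ⧸ nilradical R), I ≠ ⊥ → I.FG →
    ∃ J : FractionalIdeal (nonZeroDivisors (R ⧸ nilradical R))
        (FractionRing (R ⧸ nilradical R)),
      (I : FractionalIdeal (nonZeroDivisors (R ⧸ nilradical R))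
        (FractionRing (R ⧸ nilradical R))) * J = 1

/-- The content ideal of a polynomial: the ideal generated by its coefficients. -/
def contentIdeal {R : Type*} [CommRing R] (f : Polynomial R) : Ideal R :=
  Ideal.span (Set.range f.coeff)

/-- In a ring where any two elements `a`, `b` admit `u` with `a ∣ u * b` and `b ∣ (1 - u) * a`,
every nonempty finite set admits weights summing to one with the analogous property. -/
theorem exists_sum_eq_one_forall_dvd_mul {D : Type*} [CommRing D]
    (h : ∀ a b : D, ∃ u, a ∣ u * b ∧ b ∣ (1 - u) * a) (s : Finset D) (hs : s.Nonempty) :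
    ∃ u : D → D, ∑ a ∈ s, u a = 1 ∧ ∀ a ∈ s, ∀ b ∈ s, a ∣ u a * b := by
  classical
  induction hs using Finset.Nonempty.cons_induction with
  | singleton a => exact ⟨fun _ => 1, by simp, by simp⟩
  | cons b s hb hs ih =>
    obtain ⟨u, hsum, hu⟩ := ih
    choose t ht ht' using fun a => h a b
    have hne : ∀ a ∈ s, a ≠ b := fun a ha hab => hb (hab ▸ ha)
    refine ⟨fun a => if a = b then ∑ c ∈ s, u c * (1 - t c) else u a * t a, ?_, ?_⟩
    · rw [Finset.sum_cons, if_pos rfl, Finset.sum_congr rfl fun a ha => if_neg (hne a ha),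
        ← Finset.sum_add_distrib, Finset.sum_congr rfl fun a _ => (by ring :
          u a * (1 - t a) + u a * t a = u a), hsum]
    · intro a ha c hc
      rcases Finset.mem_cons.1 ha with rfl | ha
      · rcases Finset.mem_cons.1 hc with rfl | hc
        · exact dvd_mul_left _ _
        · simp only [if_true, Finset.sum_mul]
          refine Finset.dvd_sum fun i hi => ?_
          obtain ⟨d, hd⟩ := hu i hi c hc
          have : u i * (1 - t i) * c = (1 - t i) * i * d := by linear_combination (1 - t i) * hd
          exact this ▸ (ht' i).mul_right d
      · simp only [if_neg (hne a ha)]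
        rcases Finset.mem_cons.1 hc with rfl | hc
        · exact mul_assoc (u a) (t a) c ▸ (ht a).mul_left (u a)
        · exact (by ring : u a * t a * c = u a * c * t a) ▸ (hu a ha c hc).mul_right (t a)

/-- An elementwise criterion for all nonzero finitely generated ideals of a domain to be
invertible. -/
theorem forall_fg_invertible_iff {D : Type*} [CommRing D] [IsDomain D] :
    (∀ I : Ideal D, I ≠ ⊥ → I.FG → ∃ J : FractionalIdeal (nonZeroDivisors D) (FractionRing D),
      (I : FractionalIdeal (nonZeroDivisors D) (FractionRing D)) * J = 1) ↔
      ∀ a b : D, ∃ u, a ∣ u * b ∧ b ∣ (1 - u) * a := by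
  constructor
  · intro h a b
    by_cases ha : a = 0
    · exact ⟨0, by simp, by simp [ha]⟩
    obtain ⟨J, hJ⟩ := h (Ideal.span {a, b})
      (fun h0 => ha (Ideal.span_eq_bot.1 h0 a (Set.mem_insert a {b})))
      (Submodule.fg_span (Set.toFinite _))
    have hmem : ∀ c ∈ Ideal.span {a, b}, ∀ y ∈ J,
        ∃ d : D, algebraMap D (FractionRing D) d = algebraMap D (FractionRing D) c * y := by
      intro c hc y hy
      rw [← FractionalIdeal.mem_one_iff (nonZeroDivisors D), ← hJ]
      exact FractionalIdeal.mul_mem_mul (FractionalIdeal.mem_coeIdeal_of_mem _ hc) hy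
    have hone : (1 : FractionRing D) ∈
        (Ideal.span {a, b} : FractionalIdeal (nonZeroDivisors D) (FractionRing D)) * J :=
      hJ ▸ FractionalIdeal.one_mem_one _
    rw [Ideal.span_insert, FractionalIdeal.coeIdeal_sup,
      FractionalIdeal.coeIdeal_span_singleton, FractionalIdeal.coeIdeal_span_singleton, add_mul,
      FractionalIdeal.mem_add] at hone
    obtain ⟨p, hp, q, hq, hpq⟩ := hone
    obtain ⟨y, hy, rfl⟩ := FractionalIdeal.mem_singleton_mul.1 hp
    obtain ⟨z, hz, rfl⟩ := FractionalIdeal.mem_singleton_mul.1 hq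
    have haI : a ∈ Ideal.span {a, b} := Ideal.subset_span (by simp)
    have hbI : b ∈ Ideal.span {a, b} := Ideal.subset_span (by simp)
    obtain ⟨u, hu⟩ := hmem a haI y hy
    obtain ⟨s, hs⟩ := hmem b hbI y hy
    obtain ⟨t, ht⟩ := hmem a haI z hz
    refine ⟨u, ⟨s, IsFractionRing.injective D (FractionRing D) ?_⟩,
      ⟨t, IsFractionRing.injective D (FractionRing D) ?_⟩⟩
    · simp only [map_mul, hu, hs]
      ring
    · simp only [map_mul, map_sub, map_one, hu, ht]
      linear_combination -algebraMap D (FractionRing D) a * hpq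
  · rintro h I hI ⟨s, rfl⟩
    have hs : s.Nonempty := by
      rw [Finset.nonempty_iff_ne_empty]
      rintro rfl
      simp at hI
    obtain ⟨u, hsum, hu⟩ := exists_sum_eq_one_forall_dvd_mul h s hs
    set I := Ideal.span (s : Set D) with hIdef
    have hdvd : ∀ a ∈ s, ∀ b ∈ I, a ∣ u a * b := by
      intro a ha b hb
      have : I ≤ (Ideal.span {a}).colon {u a} :=
        Ideal.span_le.2 fun c hc => by
          simpa [Submodule.mem_colon_singleton, Ideal.mem_span_singleton, mul_comm] using hu a ha c hc
      simpa [Submodule.mem_colon_singleton, Ideal.mem_span_singleton, mul_comm] using this hb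
    refine ⟨(I : FractionalIdeal (nonZeroDivisors D) (FractionRing D))⁻¹, le_antisymm
      FractionalIdeal.mul_one_div_le_one ?_⟩
    rw [FractionalIdeal.one_le, ← map_one (algebraMap D (FractionRing D)), ← hsum, map_sum]
    refine Submodule.sum_mem _ fun a ha => ?_
    have haI : a ∈ I := Ideal.subset_span ha
    by_cases ha0 : a = 0
    · obtain ⟨b, hb, hb0⟩ := Submodule.exists_mem_ne_zero_of_ne_bot hI
      have : u a = 0 := by simpa [ha0, hb0] using hdvd a ha b hb
      rw [this, map_zero]
      exact Submodule.zero_mem _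
    have ha0' : algebraMap D (FractionRing D) a ≠ 0 := by simpa using ha0
    rw [← mul_div_cancel_left₀ (algebraMap D (FractionRing D) (u a)) ha0']
    have hI' : (I : FractionalIdeal (nonZeroDivisors D) (FractionRing D)) ≠ 0 :=
      FractionalIdeal.coeIdeal_ne_zero.2 hI
    rw [mul_div_assoc]
    refine FractionalIdeal.mul_mem_mul (FractionalIdeal.mem_coeIdeal_of_mem _ haI)
      ((FractionalIdeal.mem_inv_iff hI').2 fun y hy => ?_)
    obtain ⟨b, hb, rfl⟩ := (FractionalIdeal.mem_coeIdeal _).1 hy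
    obtain ⟨d, hd⟩ := hdvd a ha b hb
    refine (FractionalIdeal.mem_one_iff _).2 ⟨d, ?_⟩
    rw [div_mul_eq_mul_div, eq_div_iff ha0', ← map_mul, ← map_mul, hd, mul_comm]

/-- Distributivity for the principal ideals of `a`, `b` and `a - b`, elementwise. -/
theorem exists_dvd_mul_of_inf_add {R : Type*} [CommRing R] {a b : R}
    (h : Ideal.span {a} ⊓ (Ideal.span {b} + Ideal.span {a - b}) =
      Ideal.span {a} ⊓ Ideal.span {b} + Ideal.span {a} ⊓ Ideal.span {a - b}) :
    ∃ u, a ∣ u * b ∧ b ∣ (1 - u) * a := by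
  have ha : a ∈ Ideal.span {a} ⊓ (Ideal.span {b} + Ideal.span {a - b}) :=
    ⟨Ideal.mem_span_singleton_self a, Submodule.mem_sup.2
      ⟨b, Ideal.mem_span_singleton_self b, a - b, Ideal.mem_span_singleton_self _, by ring⟩⟩
  rw [h] at ha
  obtain ⟨p, ⟨hpa, hpb⟩, q, ⟨-, hq⟩, hpq⟩ := Submodule.mem_sup.1 ha
  obtain ⟨v, rfl⟩ := Ideal.mem_span_singleton.1 hpa
  obtain ⟨s, hs⟩ := Ideal.mem_span_singleton.1 hpb
  obtain ⟨t, rfl⟩ := Ideal.mem_span_singleton.1 hq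
  exact ⟨t, ⟨t - 1 + v, by linear_combination -hpq⟩, ⟨s - t, by linear_combination -hpq + hs⟩⟩

theorem phiPrufer_iff_nonnil_lattice_distributive (R : Type*) [CommRing R]
    (hR : IsPhiRing R) :
    IsPhiPrufer R ↔
      ∀ I J K : Ideal R, ¬I ≤ nilradical R → ¬J ≤ nilradical R → ¬K ≤ nilradical R →
        I ⊓ (J + K) = I ⊓ J + I ⊓ K := by
  obtain ⟨hprime, hdiv⟩ := hR
  have : IsDomain (R ⧸ nilradical R) := Ideal.Quotient.isDomain _
  rw [IsPhiPrufer, forall_fg_invertible_iff]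
  constructor
  · intro h I J K _ hJ hK
    replace hJ := (hdiv J).resolve_left hJ
    replace hK := (hdiv K).resolve_left hK
    refine le_antisymm ?_ le_inf_sup
    rintro x ⟨hxI, hx⟩
    obtain ⟨j, hj, k, hk, rfl⟩ := Submodule.mem_sup.1 hx
    obtain ⟨u, ⟨s, hs⟩, ⟨t, ht⟩⟩ :=
      h (Ideal.Quotient.mk _ j) (Ideal.Quotient.mk _ k)
    obtain ⟨u, rfl⟩ := Ideal.Quotient.mk_surjective u
    obtain ⟨s, rfl⟩ := Ideal.Quotient.mk_surjective s
    obtain ⟨t, rfl⟩ := Ideal.Quotient.mk_surjective t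
    rw [← map_one (Ideal.Quotient.mk (nilradical R)), ← map_sub] at ht
    rw [← map_mul, ← map_mul, Ideal.Quotient.mk_eq_mk_iff_sub_mem] at hs ht
    refine Submodule.mem_sup.2 ⟨u * (j + k), ⟨I.mul_mem_left _ hxI, ?_⟩,
      (1 - u) * (j + k), ⟨I.mul_mem_left _ hxI, ?_⟩, by ring⟩
    · rw [show u * (j + k) = (u + s) * j + (u * k - j * s) by ring]
      exact J.add_mem (J.mul_mem_left _ hj) (hJ hs)
    · rw [show (1 - u) * (j + k) = (1 - u + t) * k + ((1 - u) * j - k * t) by ring]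
      exact K.add_mem (K.mul_mem_left _ hk) (hK ht)
  · intro h a b
    obtain ⟨a, rfl⟩ := Ideal.Quotient.mk_surjective a
    obtain ⟨b, rfl⟩ := Ideal.Quotient.mk_surjective b
    have hspan : ∀ c : R, c ∉ nilradical R → ¬Ideal.span {c} ≤ nilradical R := fun c hc hle =>
      hc (hle (Ideal.mem_span_singleton_self c))
    by_cases ha : a ∈ nilradical R
    · exact ⟨0, by simp, by simp [Ideal.Quotient.eq_zero_iff_mem.2 ha]⟩
    by_cases hb : b ∈ nilradical R
    · exact ⟨1, by simp [Ideal.Quotient.eq_zero_iff_mem.2 hb], by simp⟩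
    by_cases hab : a - b ∈ nilradical R
    · exact ⟨0, by simp, by simp [(Ideal.Quotient.mk_eq_mk_iff_sub_mem a b).2 hab]⟩
    obtain ⟨u, h₁, h₂⟩ := exists_dvd_mul_of_inf_add
      (h _ _ _ (hspan a ha) (hspan b hb) (hspan _ hab))
    exact ⟨Ideal.Quotient.mk _ u, by simpa using map_dvd (Ideal.Quotient.mk (nilradical R)) h₁,
      by simpa using map_dvd (Ideal.Quotient.mk (nilradical R)) h₂⟩
end

section
/- Let R be a φ-ring (a commutative ring whose nilradical Nil(R) is a divided prime ideal). Then R is a φ-Prüfer ring (equivalently, R/Nil(R) is a Prüfer domain) if and only if for every pair of nonnil ideals I and J of R with I ⊆ J and J finitely generated, there exists a nonnil ideal K of R such that I = J·K. -/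
open scoped nonZeroDivisors

/-- An ideal that is invertible as a fractional ideal divides every ideal it contains. -/
theorem Ideal.exists_eq_mul_of_le_of_coeIdeal_mul_eq_one {D : Type*} [CommRing D] [IsDomain D]
    {I J : Ideal D} (hIJ : I ≤ J) {L : FractionalIdeal D⁰ (FractionRing D)}
    (hL : (J : FractionalIdeal D⁰ (FractionRing D)) * L = 1) :
    ∃ K : Ideal D, I = J * K := by
  have hle : (I : FractionalIdeal D⁰ (FractionRing D)) * L ≤ 1 := by
    rw [← hL]
    gcongr
  obtain ⟨K, hK⟩ := FractionalIdeal.le_one_iff_exists_coeIdeal.1 hle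
  refine ⟨K, FractionalIdeal.coeIdeal_injective (K := FractionRing D) ?_⟩
  change (I : FractionalIdeal D⁰ (FractionRing D)) = ((J * K : Ideal D) : FractionalIdeal D⁰ _)
  rw [FractionalIdeal.coeIdeal_mul, hK, mul_left_comm, hL, mul_one]

/-- A factor of a nonzero principal ideal of a domain is invertible as a fractional ideal. -/
theorem Ideal.exists_coeIdeal_mul_eq_one_of_mul_eq_span_singleton {D : Type*} [CommRing D]
    [IsDomain D] {I K : Ideal D} {a : D} (ha : a ≠ 0) (h : I * K = Ideal.span {a}) :
    ∃ L : FractionalIdeal D⁰ (FractionRing D),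
      (I : FractionalIdeal D⁰ (FractionRing D)) * L = 1 := by
  refine ⟨K * FractionalIdeal.spanSingleton D⁰ (algebraMap D (FractionRing D) a)⁻¹, ?_⟩
  rw [← mul_assoc, ← FractionalIdeal.coeIdeal_mul, h, FractionalIdeal.coeIdeal_span_singleton,
    FractionalIdeal.spanSingleton_mul_spanSingleton, mul_inv_cancel₀,
    FractionalIdeal.spanSingleton_one]
  simpa using ha

/-- A finitely generated ideal of a quotient ring is the image of a finitely generated ideal. -/
theorem Ideal.FG.exists_fg_map_mk_eq {R : Type*} [CommRing R] {N : Ideal R} {I : Ideal (R ⧸ N)}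
    (hI : I.FG) : ∃ J : Ideal R, J.FG ∧ J.map (Ideal.Quotient.mk N) = I := by
  obtain ⟨s, rfl⟩ := hI
  refine ⟨Ideal.span (Function.surjInv Ideal.Quotient.mk_surjective '' (s : Set (R ⧸ N))),
    Submodule.fg_span (s.finite_toSet.image _), ?_⟩
  simp [Ideal.map_span, Set.image_image, Function.surjInv_eq]

theorem Ideal.map_mk_eq_bot_iff {R : Type*} [CommRing R] {N I : Ideal R} :
    I.map (Ideal.Quotient.mk N) = ⊥ ↔ I ≤ N := by
  rw [Ideal.map_eq_bot_iff_le_ker, Ideal.mk_ker]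

theorem phiPrufer_iff_factorization (R : Type*) [CommRing R] (hR : IsPhiRing R) :
    IsPhiPrufer R ↔
      ∀ I J : Ideal R, ¬I ≤ nilradical R → ¬J ≤ nilradical R → I ≤ J → J.FG →
        ∃ K : Ideal R, ¬K ≤ nilradical R ∧ I = J * K := by
  have := hR.1
  constructor
  · intro h I J hI hJ hIJ hfg
    obtain ⟨L, hL⟩ := h (J.map (Ideal.Quotient.mk _)) (mt Ideal.map_mk_eq_bot_iff.1 hJ)
      (hfg.map _)
    obtain ⟨K, hK⟩ := Ideal.exists_eq_mul_of_le_of_coeIdeal_mul_eq_one (Ideal.map_mono hIJ) hL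
    have hKmap : (K.comap (Ideal.Quotient.mk (nilradical R))).map (Ideal.Quotient.mk _) = K :=
      Ideal.map_comap_of_surjective _ Ideal.Quotient.mk_surjective K
    have hKnil : ¬K.comap (Ideal.Quotient.mk (nilradical R)) ≤ nilradical R := by
      rw [← Ideal.map_mk_eq_bot_iff, hKmap]
      rintro rfl
      exact hI (Ideal.map_mk_eq_bot_iff.1 (by simpa using hK))
    refine ⟨_, hKnil, ?_⟩
    have hJK : ¬J * K.comap (Ideal.Quotient.mk (nilradical R)) ≤ nilradical R := fun hle =>
      (hR.1.mul_le.1 hle).elim hJ hKnil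
    have hmap : I.map (Ideal.Quotient.mk (nilradical R)) =
        (J * K.comap (Ideal.Quotient.mk (nilradical R))).map (Ideal.Quotient.mk _) := by
      rw [Ideal.map_mul, hKmap, hK]
    have hcomap := congrArg (Ideal.comap (Ideal.Quotient.mk (nilradical R))) hmap
    rwa [Ideal.comap_map_mk ((hR.2 _).resolve_left hI),
      Ideal.comap_map_mk ((hR.2 _).resolve_left hJK)] at hcomap
  · intro h I hI hfg
    obtain ⟨J, hJfg, rfl⟩ := hfg.exists_fg_map_mk_eq
    have hJ : ¬J ≤ nilradical R := mt Ideal.map_mk_eq_bot_iff.2 hI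
    obtain ⟨a, haJ, ha⟩ := SetLike.not_le_iff_exists.1 hJ
    obtain ⟨K, -, hK⟩ := h (Ideal.span {a}) J (by simpa [Ideal.span_singleton_le_iff_mem] using ha)
      hJ ((Ideal.span_singleton_le_iff_mem J).2 haJ) hJfg
    refine Ideal.exists_coeIdeal_mul_eq_one_of_mul_eq_span_singleton
      (mt Ideal.Quotient.eq_zero_iff_mem.1 ha)
      (K := K.map (Ideal.Quotient.mk _)) ?_
    rw [← Ideal.map_mul, ← hK, Ideal.map_span, Set.image_singleton]
end

section
/- Let R be a φ-ring (a commutative ring whose nilradical Nil(R) is a divided prime ideal). Then R is a φ-Prüfer ring (equivalently, R/Nil(R) is a Prüfer domain) if and only if (I + J) : K = (I : K) + (J : K) for arbitrary nonnil ideals I and J of R and every finitely generated ideal K of R. -/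
/-- A finitely generated ideal below a sum is below a sum of finitely generated pieces. -/
theorem exists_fg_le_sup_of_le_sup {R : Type*} [CommRing R] {I J L : Ideal R} (hL : L.FG)
    (h : L ≤ I ⊔ J) :
    ∃ A B : Ideal R, A.FG ∧ B.FG ∧ A ≤ I ∧ B ≤ J ∧ L ≤ A ⊔ B := by
  induction L, hL using Submodule.fg_induction with
  | singleton x =>
    obtain ⟨a, ha, b, hb, hab⟩ :=
      Submodule.mem_sup.1 (h (Submodule.mem_span_singleton_self x))
    refine ⟨Ideal.span {a}, Ideal.span {b}, Submodule.fg_span_singleton a,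
      Submodule.fg_span_singleton b, ?_, ?_, ?_⟩
    · simpa [Ideal.span_le] using ha
    · simpa [Ideal.span_le] using hb
    · rw [Submodule.span_singleton_le_iff_mem, ← hab]
      exact Submodule.add_mem_sup (Ideal.mem_span_singleton_self a)
        (Ideal.mem_span_singleton_self b)
  | sup L₁ L₂ _ _ ih₁ ih₂ =>
    obtain ⟨A₁, B₁, hA₁, hB₁, hI₁, hJ₁, hL₁⟩ := ih₁ (le_sup_left.trans h)
    obtain ⟨A₂, B₂, hA₂, hB₂, hI₂, hJ₂, hL₂⟩ := ih₂ (le_sup_right.trans h)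
    refine ⟨A₁ ⊔ A₂, B₁ ⊔ B₂, Submodule.FG.sup hA₁ hA₂, Submodule.FG.sup hB₁ hB₂,
      sup_le hI₁ hI₂, sup_le hJ₁ hJ₂, ?_⟩
    rw [sup_sup_sup_comm]
    exact sup_le_sup hL₁ hL₂

/-- Finitely generated ideals lift along surjective ring homomorphisms. -/
theorem Ideal.FG.exists_fg_map_eq {R S : Type*} [CommRing R] [CommRing S] {f : R →+* S}
    (hf : Function.Surjective f) {A : Ideal S} (hA : A.FG) :
    ∃ A₀ : Ideal R, A₀.FG ∧ A₀.map f = A := by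
  induction A, hA using Submodule.fg_induction with
  | singleton x =>
    obtain ⟨r, rfl⟩ := hf x
    refine ⟨Ideal.span {r}, Submodule.fg_span_singleton r, ?_⟩
    rw [Ideal.map_span, Set.image_singleton]
  | sup A B _ _ ihA ihB =>
    obtain ⟨A₀, hA₀, rfl⟩ := ihA
    obtain ⟨B₀, hB₀, rfl⟩ := ihB
    exact ⟨A₀ ⊔ B₀, Submodule.FG.sup hA₀ hB₀, Ideal.map_sup f A₀ B₀⟩

section Domain

open FractionalIdeal nonZeroDivisors

variable {D : Type*} [CommRing D] [IsDomain D]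

/-- If `A ⊔ B` is invertible, then the residuals `(A : B)` and `(B : A)` are comaximal. -/
theorem exists_mul_le_of_sup_invertible {A B : Ideal D}
    {C : FractionalIdeal D⁰ (FractionRing D)}
    (hC : ((A ⊔ B : Ideal D) : FractionalIdeal D⁰ (FractionRing D)) * C = 1) :
    ∃ u v : D, u + v = 1 ∧ Ideal.span {u} * B ≤ A ∧ Ideal.span {v} * A ≤ B := by
  have hsum : (A : FractionalIdeal D⁰ (FractionRing D)) * C + B * C = 1 := by
    rw [← add_mul, ← coeIdeal_sup, ← hC]
  have hA : (A : FractionalIdeal D⁰ (FractionRing D)) * C ≤ 1 := by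
    rw [← hsum]; exact le_sup_left
  have hB : (B : FractionalIdeal D⁰ (FractionRing D)) * C ≤ 1 := by
    rw [← hsum]; exact le_sup_right
  obtain ⟨P, hP⟩ := le_one_iff_exists_coeIdeal.1 hA
  obtain ⟨Q, hQ⟩ := le_one_iff_exists_coeIdeal.1 hB
  have hPQ : P ⊔ Q = ⊤ := by
    apply coeIdeal_injective (K := FractionRing D)
    change ((P ⊔ Q : Ideal D) : FractionalIdeal D⁰ (FractionRing D)) = ((⊤ : Ideal D) : _)
    rw [coeIdeal_sup, hP, hQ, hsum, coeIdeal_top]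
  obtain ⟨u, hu, v, hv, huv⟩ := Submodule.mem_sup.1 (hPQ ▸ Submodule.mem_top : (1 : D) ∈ P ⊔ Q)
  have hPB : P * B ≤ A := by
    rw [← coeIdeal_le_coeIdeal (FractionRing D), coeIdeal_mul, hP, mul_right_comm, mul_assoc]
    exact (mul_le_mul_right hB _).trans (mul_one _).le
  have hQA : Q * A ≤ B := by
    rw [← coeIdeal_le_coeIdeal (FractionRing D), coeIdeal_mul, hQ, mul_right_comm, mul_assoc]
    exact (mul_le_mul_right hA _).trans (mul_one _).le
  exact ⟨u, v, huv,
    (Ideal.mul_mono_left ((Ideal.span_singleton_le_iff_mem _).2 hu)).trans hPB,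
    (Ideal.mul_mono_left ((Ideal.span_singleton_le_iff_mem _).2 hv)).trans hQA⟩

/-- The sum of two invertible ideals with comaximal residuals is invertible. -/
theorem exists_sup_mul_eq_one {A B : Ideal D}
    {A' B' : FractionalIdeal D⁰ (FractionRing D)}
    (hA : (A : FractionalIdeal D⁰ (FractionRing D)) * A' = 1)
    (hB : (B : FractionalIdeal D⁰ (FractionRing D)) * B' = 1)
    {u v : D} (huv : u + v = 1) (hu : Ideal.span {u} * B ≤ A) (hv : Ideal.span {v} * A ≤ B) :
    ∃ C : FractionalIdeal D⁰ (FractionRing D),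
      ((A ⊔ B : Ideal D) : FractionalIdeal D⁰ (FractionRing D)) * C = 1 := by
  rw [← coeIdeal_le_coeIdeal (FractionRing D), coeIdeal_mul] at hu hv
  have hsum : ((Ideal.span {u} : Ideal D) : FractionalIdeal D⁰ (FractionRing D)) +
      (Ideal.span {v} : Ideal D) = 1 := by
    rw [← coeIdeal_top, ← coeIdeal_sup, coeIdeal_inj, Ideal.eq_top_iff_one, ← huv]
    exact Submodule.add_mem_sup (Ideal.mem_span_singleton_self u)
      (Ideal.mem_span_singleton_self v)
  generalize ((Ideal.span {u} : Ideal D) : FractionalIdeal D⁰ (FractionRing D)) = U at *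
  generalize ((Ideal.span {v} : Ideal D) : FractionalIdeal D⁰ (FractionRing D)) = V at *
  rw [coeIdeal_sup]
  generalize (A : FractionalIdeal D⁰ (FractionRing D)) = a at *
  generalize (B : FractionalIdeal D⁰ (FractionRing D)) = b at *
  have h₁ : U * b * A' ≤ 1 := hA ▸ mul_le_mul_left hu A'
  have h₂ : V * a * B' ≤ 1 := hB ▸ mul_le_mul_left hv B'
  have key : (a + b) * (U * A' + V * B') = 1 + (U * b * A' + V * a * B') := by
    calc _ = U * (a * A') + V * (b * B') + (U * b * A' + V * a * B') := by ring
      _ = _ := by rw [hA, hB, mul_one, mul_one, hsum]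
  refine ⟨U * A' + V * B', key.trans (le_antisymm ?_ ?_)⟩
  · exact sup_le le_rfl (sup_le h₁ h₂)
  · exact le_sup_left

/-- A domain is Prüfer as soon as any two nonzero finitely generated ideals have comaximal
residuals. -/
theorem exists_mul_eq_one_of_comaximal_residuals
    (h : ∀ A B : Ideal D, A ≠ ⊥ → B ≠ ⊥ → A.FG → B.FG →
      ∃ u v : D, u + v = 1 ∧ Ideal.span {u} * B ≤ A ∧ Ideal.span {v} * A ≤ B)
    {I : Ideal D} (hI : I ≠ ⊥) (hfg : I.FG) :
    ∃ C : FractionalIdeal D⁰ (FractionRing D),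
      (I : FractionalIdeal D⁰ (FractionRing D)) * C = 1 := by
  induction I, hfg using Submodule.fg_induction with
  | singleton x =>
    have hx : algebraMap D (FractionRing D) x ≠ 0 := by
      rw [Ne, FaithfulSMul.algebraMap_eq_zero_iff]
      rintro rfl
      exact hI (by simp)
    refine ⟨spanSingleton D⁰ (algebraMap D (FractionRing D) x)⁻¹, ?_⟩
    change ((Ideal.span {x} : Ideal D) : FractionalIdeal D⁰ (FractionRing D)) * _ = 1
    rw [coeIdeal_span_singleton, spanSingleton_mul_spanSingleton, mul_inv_cancel₀ hx,
      spanSingleton_one]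
  | sup A B hA hB ihA ihB =>
    by_cases hA0 : A = ⊥
    · subst hA0
      rw [bot_sup_eq] at hI ⊢
      exact ihB hI
    by_cases hB0 : B = ⊥
    · subst hB0
      rw [sup_bot_eq] at hI ⊢
      exact ihA hI
    obtain ⟨A', hA'⟩ := ihA hA0
    obtain ⟨B', hB'⟩ := ihB hB0
    obtain ⟨u, v, huv, hu, hv⟩ := h A B hA0 hB0 hA hB
    exact exists_sup_mul_eq_one hA' hB' huv hu hv

end Domain

theorem phiPrufer_iff_colon_add (R : Type*) [CommRing R] (hR : IsPhiRing R) :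
    IsPhiPrufer R ↔
      ∀ I J : Ideal R, ¬I ≤ nilradical R → ¬J ≤ nilradical R →
        ∀ K : Ideal R, K.FG → (I + J).colon K = I.colon K + J.colon K := by
  obtain ⟨hprime, hdiv⟩ := hR
  have : IsDomain (R ⧸ nilradical R) := Ideal.Quotient.isDomain _
  have hsurj := Ideal.Quotient.mk_surjective (I := nilradical R)
  constructor
  · intro hP I J hI hJ K hK
    have hNI := (hdiv I).resolve_left hI
    have hNJ := (hdiv J).resolve_left hJ
    refine le_antisymm (fun x hx => ?_)
      (sup_le (Submodule.colon_mono le_sup_left le_rfl)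
        (Submodule.colon_mono le_sup_right le_rfl))
    have hxK : Ideal.span {x} * K ≤ I ⊔ J :=
      Ideal.span_singleton_mul_le_iff.2 fun k hk => Submodule.mem_colon.1 hx k hk
    obtain ⟨A, B, hA, hB, hAI, hBJ, hAB⟩ := exists_fg_le_sup_of_le_sup
      (Submodule.FG.mul (Submodule.fg_span_singleton x) hK) hxK
    set π := Ideal.Quotient.mk (nilradical R)
    have hcomax : ∃ u v : R ⧸ nilradical R, u + v = 1 ∧
        Ideal.span {u} * B.map π ≤ A.map π ∧ Ideal.span {v} * A.map π ≤ B.map π := by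
      by_cases h0 : A.map π ⊔ B.map π = ⊥
      · obtain ⟨hA0, hB0⟩ := sup_eq_bot_iff.1 h0
        exact ⟨1, 0, by simp, by simp [hB0], by simp [hA0]⟩
      · obtain ⟨C, hC⟩ := hP _ h0 (Submodule.FG.sup (hA.map π) (hB.map π))
        exact exists_mul_le_of_sup_invertible hC
    obtain ⟨u, v, huv, hu, hv⟩ := hcomax
    obtain ⟨u, rfl⟩ := hsurj u
    obtain ⟨w, hw⟩ : ∃ w, w = 1 - u := ⟨_, rfl⟩
    obtain rfl : v = π w := by
      rw [hw, map_sub, map_one, ← huv]; exact (add_sub_cancel_left _ _).symm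
    have pull : ∀ {r : R} {P Q I : Ideal R}, nilradical R ≤ I → Q ≤ I →
        Ideal.span {π r} * P.map π ≤ Q.map π → ∀ p ∈ P, r * p ∈ I := by
      intro r P Q I hN hQ h p hp
      have h1 : π (r * p) ∈ I.map π := by
        rw [map_mul]
        exact Ideal.map_mono hQ (Ideal.span_singleton_mul_le_iff.1 h _ (Ideal.mem_map_of_mem π hp))
      exact (Ideal.mem_quotient_iff_mem hN).1 h1
    have hmem : ∀ k ∈ K, ∃ a ∈ A, ∃ b ∈ B, a + b = x * k := fun k hk =>
      Submodule.mem_sup.1 (hAB (Ideal.mul_mem_mul (Ideal.mem_span_singleton_self x) hk))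
    have hx' : x = u * x + w * x := by rw [hw]; ring
    rw [hx']
    refine Submodule.add_mem_sup (Submodule.mem_colon.2 fun k hk => ?_)
      (Submodule.mem_colon.2 fun k hk => ?_)
    · obtain ⟨a, ha, b, hb, hab⟩ := hmem k hk
      rw [smul_eq_mul, mul_assoc, ← hab, mul_add]
      exact I.add_mem (I.mul_mem_left _ (hAI ha)) (pull hNI hAI hu b hb)
    · obtain ⟨a, ha, b, hb, hab⟩ := hmem k hk
      rw [smul_eq_mul, mul_assoc, ← hab, mul_add]
      exact J.add_mem (pull hNJ hBJ hv a ha) (J.mul_mem_left _ (hBJ hb))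
  · intro h I hI hfg
    refine exists_mul_eq_one_of_comaximal_residuals (fun A B hA0 hB0 hA hB => ?_) hI hfg
    obtain ⟨A, hAfg, rfl⟩ := hA.exists_fg_map_eq hsurj
    obtain ⟨B, hBfg, rfl⟩ := hB.exists_fg_map_eq hsurj
    have hnonnil : ∀ {P : Ideal R}, P.map (Ideal.Quotient.mk (nilradical R)) ≠ ⊥ →
        ¬P ≤ nilradical R := fun hP hle => hP (Ideal.map_mk_eq_bot_of_le hle)
    have hcolon := h A B (hnonnil hA0) (hnonnil hB0) (A ⊔ B)
      (Submodule.FG.sup hAfg hBfg)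
    have hone : (1 : R) ∈ (A + B).colon ((A ⊔ B : Ideal R) : Set R) :=
      Submodule.mem_colon.2 fun p hp => by rwa [one_smul]
    rw [hcolon] at hone
    obtain ⟨u, hu, v, hv, huv⟩ := Submodule.mem_sup.1 hone
    refine ⟨Ideal.Quotient.mk _ u, Ideal.Quotient.mk _ v, by rw [← map_add, huv, map_one], ?_, ?_⟩
    · rw [← Set.image_singleton, ← Ideal.map_span, ← Ideal.map_mul]
      exact Ideal.map_mono (Ideal.span_singleton_mul_le_iff.2 fun b hb =>
        Submodule.mem_colon.1 hu b (le_sup_right (a := A) hb))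
    · rw [← Set.image_singleton, ← Ideal.map_span, ← Ideal.map_mul]
      exact Ideal.map_mono (Ideal.span_singleton_mul_le_iff.2 fun a ha =>
        Submodule.mem_colon.1 hv a (le_sup_left (b := B) ha))
end

section
/- Let R be a φ-ring (a commutative ring whose nilradical Nil(R) is a divided prime ideal). Then R is a φ-Prüfer ring (equivalently, R/Nil(R) is a Prüfer domain) if and only if K : (I ∩ J) = (K : I) + (K : J) for all finitely generated nonnil ideals I and J of R and every ideal K of R. -/
section Domain

variable {D : Type*} [CommRing D]

open nonZeroDivisors

/-- If `I ⊔ J` is invertible, then `(I : J)` and `(J : I)` are comaximal. -/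
theorem exists_add_eq_one_of_sup_invertible {I J : Ideal D}
    {L : FractionalIdeal D⁰ (FractionRing D)}
    (hL : ((I ⊔ J : Ideal D) : FractionalIdeal D⁰ (FractionRing D)) * L = 1) :
    ∃ u v : D, u + v = 1 ∧ (∀ y ∈ J, u * y ∈ I) ∧ ∀ x ∈ I, v * x ∈ J := by
  have hsum : (I : FractionalIdeal D⁰ (FractionRing D)) * L + J * L = 1 := by
    rw [← hL, FractionalIdeal.coeIdeal_sup, add_mul]
  have key : ∀ A B : Ideal D, (A : FractionalIdeal D⁰ (FractionRing D)) * L + B * L = 1 →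
      ∀ u : D, algebraMap D (FractionRing D) u ∈
        (A : FractionalIdeal D⁰ (FractionRing D)) * L → ∀ y ∈ B, u * y ∈ A := by
    intro A B hAB u hu y hy
    have hBL : (B : FractionalIdeal D⁰ (FractionRing D)) * L ≤ 1 := by
      rw [← hAB, ← FractionalIdeal.sup_eq_add]; exact le_sup_right
    have hle : (A : FractionalIdeal D⁰ (FractionRing D)) * L * B ≤ A := by
      rw [mul_assoc, mul_comm L]
      simpa using mul_le_mul_right hBL (A : FractionalIdeal D⁰ (FractionRing D))
    have hmem := hle (FractionalIdeal.mul_mem_mul hu (FractionalIdeal.mem_coeIdeal_of_mem _ hy))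
    rw [← map_mul] at hmem
    obtain ⟨z, hz, hzu⟩ := (FractionalIdeal.mem_coeIdeal _).1 hmem
    rwa [← IsFractionRing.injective D (FractionRing D) hzu]
  have hsum' : (J : FractionalIdeal D⁰ (FractionRing D)) * L + I * L = 1 := by
    rw [add_comm, hsum]
  have hone : (1 : FractionRing D) ∈ (I : FractionalIdeal D⁰ (FractionRing D)) * L + J * L := by
    rw [hsum]; exact FractionalIdeal.one_mem_one _
  obtain ⟨u, hu, v, hv, huv⟩ := (FractionalIdeal.mem_add _ _ _).1 hone
  have hIL : (I : FractionalIdeal D⁰ (FractionRing D)) * L ≤ 1 := by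
    rw [← hsum, ← FractionalIdeal.sup_eq_add]; exact le_sup_left
  have hJL : (J : FractionalIdeal D⁰ (FractionRing D)) * L ≤ 1 := by
    rw [← hsum, ← FractionalIdeal.sup_eq_add]; exact le_sup_right
  obtain ⟨u, rfl⟩ := (FractionalIdeal.mem_one_iff _).1 (hIL hu)
  obtain ⟨v, rfl⟩ := (FractionalIdeal.mem_one_iff _).1 (hJL hv)
  refine ⟨u, v, ?_, key I J hsum u hu, key J I hsum' v hv⟩
  apply IsFractionRing.injective D (FractionRing D)
  simpa using huv

/-- If `I` and `J` are invertible and `(I : J)`, `(J : I)` are comaximal, then `I ⊔ J` is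
invertible. -/
theorem sup_invertible_of_comaximal {I J U V : Ideal D}
    (hUV : U ⊔ V = ⊤) (hU : U * J ≤ I) (hV : V * I ≤ J)
    {I' J' : FractionalIdeal D⁰ (FractionRing D)}
    (hI : (I : FractionalIdeal D⁰ (FractionRing D)) * I' = 1)
    (hJ : (J : FractionalIdeal D⁰ (FractionRing D)) * J' = 1) :
    ∃ L : FractionalIdeal D⁰ (FractionRing D),
      ((I ⊔ J : Ideal D) : FractionalIdeal D⁰ (FractionRing D)) * L = 1 := by
  have hUV' : (U : FractionalIdeal D⁰ (FractionRing D)) + V = 1 := by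
    rw [← FractionalIdeal.coeIdeal_sup, hUV, FractionalIdeal.coeIdeal_top]
  have key : ∀ {A B C : Ideal D} {A' : FractionalIdeal D⁰ (FractionRing D)},
      C * B ≤ A → (A : FractionalIdeal D⁰ (FractionRing D)) * A' = 1 →
      (C : FractionalIdeal D⁰ (FractionRing D)) * B * A' ≤ 1 := by
    intro A B C A' hC hA
    rw [← hA, ← FractionalIdeal.coeIdeal_mul]
    exact mul_le_mul_left ((FractionalIdeal.coeIdeal_le_coeIdeal _).2 hC) A'
  refine ⟨U * I' + V * J', ?_⟩
  rw [FractionalIdeal.coeIdeal_sup]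
  calc ((I : FractionalIdeal D⁰ (FractionRing D)) + J) * (U * I' + V * J')
      = U * (I * I') + V * (J * J') + (U * J * I' + V * I * J') := by ring
    _ = 1 ⊔ (U * J * I' ⊔ V * I * J') := by
      rw [hI, hJ, mul_one, mul_one, hUV', FractionalIdeal.sup_eq_add, FractionalIdeal.sup_eq_add]
    _ = 1 := sup_eq_left.2 (sup_le (key hU hI) (key hV hJ))

/-- If `(I : J)` and `(J : I)` are comaximal for all nonzero finitely generated ideals, then
nonzero finitely generated ideals are invertible. -/
theorem invertible_of_comaximal [IsDomain D]
    (h : ∀ I J : Ideal D, I ≠ ⊥ → J ≠ ⊥ → I.FG → J.FG →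
      ∃ U V : Ideal D, U ⊔ V = ⊤ ∧ U * J ≤ I ∧ V * I ≤ J)
    {I : Ideal D} (hI : I ≠ ⊥) (hfg : I.FG) :
    ∃ L : FractionalIdeal D⁰ (FractionRing D),
      (I : FractionalIdeal D⁰ (FractionRing D)) * L = 1 := by
  suffices hP : I.FG ∧ (I ≠ ⊥ → ∃ L : FractionalIdeal D⁰ (FractionRing D),
      (I : FractionalIdeal D⁰ (FractionRing D)) * L = 1) from hP.2 hI
  clear hI
  induction I, hfg using Submodule.fg_induction with
  | singleton x =>
    refine ⟨Submodule.fg_span_singleton x, fun hx => ?_⟩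
    have hx0 : algebraMap D (FractionRing D) x ≠ 0 := by
      rw [Ne, FaithfulSMul.algebraMap_eq_zero_iff]
      rintro rfl
      simp at hx
    refine ⟨FractionalIdeal.spanSingleton _ (algebraMap D (FractionRing D) x)⁻¹, ?_⟩
    rw [Ideal.submodule_span_eq, FractionalIdeal.coeIdeal_span_singleton,
      FractionalIdeal.spanSingleton_mul_spanSingleton, mul_inv_cancel₀ hx0,
      FractionalIdeal.spanSingleton_one]
  | sup I J _ _ ihI ihJ =>
    refine ⟨Submodule.FG.sup ihI.1 ihJ.1, fun hIJ => ?_⟩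
    by_cases hI : I = ⊥
    · subst hI
      simp only [bot_sup_eq] at hIJ ⊢
      exact ihJ.2 hIJ
    by_cases hJ : J = ⊥
    · subst hJ
      simp only [sup_bot_eq] at hIJ ⊢
      exact ihI.2 hIJ
    obtain ⟨I', hI'⟩ := ihI.2 hI
    obtain ⟨J', hJ'⟩ := ihJ.2 hJ
    obtain ⟨U, V, hUV, hU, hV⟩ := h I J hI hJ ihI.1 ihJ.1
    exact sup_invertible_of_comaximal hUV hU hV hI' hJ'

end Domain

/-- A finitely generated ideal of a quotient ring lifts to a finitely generated ideal. -/
theorem Ideal.FG.exists_map_mk_eq {R : Type*} [CommRing R] {N : Ideal R} {I : Ideal (R ⧸ N)}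
    (hI : I.FG) : ∃ I' : Ideal R, I'.FG ∧ I'.map (Ideal.Quotient.mk N) = I := by
  classical
  obtain ⟨s, rfl⟩ := hI
  obtain ⟨t, rfl⟩ : ∃ t : Finset R, t.image (Ideal.Quotient.mk N) = s :=
    ⟨s.image Quotient.out, by simp [Finset.image_image, Function.comp_def]⟩
  exact ⟨Ideal.span t, ⟨t, rfl⟩, by simp [Ideal.map_span]⟩

/-- In a φ-Prüfer φ-ring, the residuals `(I : J)` and `(J : I)` of finitely generated nonnil
ideals are comaximal. -/
theorem IsPhiPrufer.exists_add_eq_one {R : Type*} [CommRing R] (hR : IsPhiRing R)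
    (h : IsPhiPrufer R) {I J : Ideal R} (hI : ¬I ≤ nilradical R) (hJ : ¬J ≤ nilradical R)
    (hIfg : I.FG) (hJfg : J.FG) :
    ∃ u v : R, u + v = 1 ∧ (∀ y ∈ J, u * y ∈ I) ∧ ∀ x ∈ I, v * x ∈ J := by
  have := hR.1
  have hNI := (hR.2 I).resolve_left hI
  have hNJ := (hR.2 J).resolve_left hJ
  let π := Ideal.Quotient.mk (nilradical R)
  have lift : ∀ {A : Ideal R}, nilradical R ≤ A → ∀ {a : R}, π a ∈ A.map π → a ∈ A := by
    intro A hA a ha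
    rw [← Ideal.mem_comap, Ideal.comap_map_of_surjective' _ Ideal.Quotient.mk_surjective,
      Ideal.mk_ker, sup_eq_left.2 hA] at ha
    exact ha
  have hne : I.map π ⊔ J.map π ≠ ⊥ := by
    intro h0
    exact hI (by simpa [π, Ideal.map_eq_bot_iff_le_ker, Ideal.mk_ker] using (sup_eq_bot_iff.1 h0).1)
  obtain ⟨L, hL⟩ := h _ hne (Submodule.FG.sup (hIfg.map π) (hJfg.map π))
  obtain ⟨u, v, huv, hu, hv⟩ := exists_add_eq_one_of_sup_invertible hL
  obtain ⟨u, rfl⟩ := Ideal.Quotient.mk_surjective u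
  refine ⟨u, 1 - u, by ring, fun y hy => lift hNI ?_, fun x hx => lift hNJ ?_⟩
  · simpa [π] using hu (π y) (Ideal.mem_map_of_mem π hy)
  · rw [← eq_sub_iff_add_eq'] at huv
    simpa [π, huv] using hv (π x) (Ideal.mem_map_of_mem π hx)

theorem phiPrufer_iff_colon_inf (R : Type*) [CommRing R] (hR : IsPhiRing R) :
    IsPhiPrufer R ↔
      ∀ I J : Ideal R, ¬I ≤ nilradical R → ¬J ≤ nilradical R → I.FG → J.FG →
        ∀ K : Ideal R, K.colon (I ⊓ J) = K.colon I + K.colon J := by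
  constructor
  · intro h I J hI hJ hIfg hJfg K
    obtain ⟨u, v, huv, hu, hv⟩ := h.exists_add_eq_one hR hI hJ hIfg hJfg
    apply le_antisymm
    · intro x hx
      rw [Submodule.mem_colon] at hx
      rw [← mul_one x, ← huv, mul_add, add_comm (x * u)]
      refine Submodule.add_mem_sup (Submodule.mem_colon.2 fun y hy => ?_)
        (Submodule.mem_colon.2 fun y hy => ?_)
      · simpa [mul_assoc] using hx (v * y) ⟨I.mul_mem_left v hy, hv y hy⟩
      · simpa [mul_assoc] using hx (u * y) ⟨hu y hy, J.mul_mem_left u hy⟩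
    · exact sup_le (Submodule.colon_mono le_rfl fun _ hx => hx.1)
        (Submodule.colon_mono le_rfl fun _ hx => hx.2)
  · intro h I hI hfg
    have := hR.1
    refine invertible_of_comaximal (fun I J hI hJ hIfg hJfg => ?_) hI hfg
    obtain ⟨I, hI', rfl⟩ := hIfg.exists_map_mk_eq
    obtain ⟨J, hJ', rfl⟩ := hJfg.exists_map_mk_eq
    rw [Ne, Ideal.map_eq_bot_iff_le_ker, Ideal.mk_ker] at hI hJ
    have hIJ := h I J hI hJ hI' hJ' (I ⊓ J)
    have htop : (I ⊓ J).colon (I ⊓ J) = ⊤ :=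
      (Ideal.eq_top_iff_one _).2 (Submodule.mem_colon.2 fun y hy => by simpa using hy)
    rw [htop] at hIJ
    refine ⟨((I ⊓ J).colon J).map (Ideal.Quotient.mk (nilradical R)),
      ((I ⊓ J).colon I).map (Ideal.Quotient.mk (nilradical R)), ?_, ?_, ?_⟩
    · rw [← Ideal.map_sup, sup_comm]
      exact (congrArg (Ideal.map _) hIJ.symm).trans (Ideal.map_top _)
    all_goals
      rw [← Ideal.map_mul]
      refine Ideal.map_mono (Ideal.mul_le.2 fun r hr s hs => ?_)
      have hrs := Submodule.mem_colon.1 hr s hs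
    exacts [hrs.1, hrs.2]
end

section
/- Let R be a φ-ring (a commutative ring whose nilradical Nil(R) is a divided prime ideal). Then R is a φ-Prüfer ring (equivalently, R/Nil(R) is a Prüfer domain) if and only if (I ∩ J) · K = (I · K) ∩ (J · K) for any three nonnil ideals I, J, K of R. -/
open nonZeroDivisors

theorem Ideal.exists_fg_le_mem_mul {R : Type*} [CommSemiring R] {I K : Ideal R} {x : R}
    (hx : x ∈ I * K) : ∃ L ≤ K, L.FG ∧ x ∈ I * L := by
  obtain ⟨T, T', hT, hT', hx⟩ := Submodule.mem_span_mul_finite_of_mem_mul hx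
  refine ⟨Ideal.span T', Ideal.span_le.mpr hT', ⟨T', rfl⟩, ?_⟩
  refine Ideal.mul_mono_left (Ideal.span_le.mpr hT) ?_
  rwa [Ideal.span_mul_span']

theorem Ideal.inf_mul_of_isUnit_coeIdeal {D : Type*} [CommRing D] [IsDomain D] {K : Ideal D}
    (hK : IsUnit (K : FractionalIdeal D⁰ (FractionRing D))) (I J : Ideal D) :
    (I ⊓ J) * K = (I * K) ⊓ (J * K) := by
  refine le_antisymm (le_inf (Ideal.mul_mono_left inf_le_left)
    (Ideal.mul_mono_left inf_le_right)) ?_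
  obtain ⟨L, hL⟩ := hK.exists_right_inv
  have le_of_le (A B : Ideal D) (hAB : A ≤ B * K) :
      (A : FractionalIdeal D⁰ (FractionRing D)) * L ≤ B := by
    calc (A : FractionalIdeal D⁰ (FractionRing D)) * L
        ≤ ((B * K : Ideal D) : FractionalIdeal D⁰ (FractionRing D)) * L :=
          mul_le_mul_left ((FractionalIdeal.coeIdeal_le_coeIdeal _).mpr hAB) L
      _ = B := by rw [FractionalIdeal.coeIdeal_mul, mul_assoc, hL, mul_one]
  rw [← FractionalIdeal.coeIdeal_le_coeIdeal (FractionRing D), FractionalIdeal.coeIdeal_mul,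
    FractionalIdeal.coeIdeal_inf I J]
  have h := mul_le_mul_left (le_inf (le_of_le _ I inf_le_left) (le_of_le _ J inf_le_right))
    (K : FractionalIdeal D⁰ (FractionRing D))
  rwa [mul_assoc, mul_comm L, hL, mul_one] at h

/-- Multiplication by an ideal distributes over intersections in a domain whose nonzero finitely
generated ideals are all invertible. -/
theorem Ideal.inf_mul_of_forall_fg_isUnit {D : Type*} [CommRing D] [IsDomain D]
    (h : ∀ I : Ideal D, I ≠ ⊥ → I.FG → IsUnit (I : FractionalIdeal D⁰ (FractionRing D)))
    (I J K : Ideal D) : (I ⊓ J) * K = (I * K) ⊓ (J * K) := by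
  refine le_antisymm (le_inf (Ideal.mul_mono_left inf_le_left)
    (Ideal.mul_mono_left inf_le_right)) fun x ⟨hxI, hxJ⟩ ↦ ?_
  obtain ⟨L, hLK, hL, hxL⟩ := Ideal.exists_fg_le_mem_mul hxI
  obtain ⟨M, hMK, hM, hxM⟩ := Ideal.exists_fg_le_mem_mul hxJ
  refine Ideal.mul_mono_right (sup_le hLK hMK) ?_
  have hx : x ∈ I * (L ⊔ M) ⊓ J * (L ⊔ M) :=
    ⟨Ideal.mul_mono_right le_sup_left hxL, Ideal.mul_mono_right le_sup_right hxM⟩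
  by_cases h0 : L ⊔ M = ⊥
  · simpa [h0] using hx
  · rwa [Ideal.inf_mul_of_isUnit_coeIdeal (h _ h0 (Submodule.FG.sup hL hM))]

/-- In a domain where multiplication by nonzero ideals distributes over intersections, every
nonzero finitely generated ideal is invertible. -/
theorem Ideal.isUnit_of_forall_inf_mul {D : Type*} [CommRing D] [IsDomain D]
    (h : ∀ I J K : Ideal D, I ≠ ⊥ → J ≠ ⊥ → K ≠ ⊥ → (I ⊓ J) * K = (I * K) ⊓ (J * K))
    (I : Ideal D) (hI : I ≠ ⊥) (hfg : I.FG) :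
    IsUnit (I : FractionalIdeal D⁰ (FractionRing D)) := by
  induction I, hfg using Submodule.fg_induction with
  | singleton x =>
    have hx : x ≠ 0 := by rintro rfl; simp at hI
    change IsUnit ((Ideal.span {x} : Ideal D) : FractionalIdeal D⁰ (FractionRing D))
    rw [FractionalIdeal.coeIdeal_span_singleton]
    refine IsUnit.of_mul_eq_one
      (FractionalIdeal.spanSingleton D⁰ (algebraMap D (FractionRing D) x)⁻¹) ?_
    rw [FractionalIdeal.spanSingleton_mul_spanSingleton, mul_inv_cancel₀ (by simpa using hx),
      FractionalIdeal.spanSingleton_one]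
  | sup I J _ _ ihI ihJ =>
    by_cases hI0 : I = ⊥
    · subst hI0; rw [bot_sup_eq] at hI ⊢; exact ihJ hI
    by_cases hJ0 : J = ⊥
    · subst hJ0; rw [sup_bot_eq] at hI ⊢; exact ihI hI
    have key : (I ⊓ J) * (I ⊔ J) = I * J := by
      apply le_antisymm
      · rw [Ideal.mul_sup, mul_comm (I ⊓ J) I]
        exact sup_le (Ideal.mul_mono_right inf_le_right) (Ideal.mul_mono_left inf_le_left)
      · rw [h I J _ hI0 hJ0 hI]
        refine le_inf (Ideal.mul_mono_right le_sup_right) ?_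
        rw [mul_comm I J]
        exact Ideal.mul_mono_right le_sup_left
    refine isUnit_of_mul_isUnit_right (x := ((I ⊓ J : Ideal D) : FractionalIdeal D⁰ _)) ?_
    rw [← FractionalIdeal.coeIdeal_mul, key, FractionalIdeal.coeIdeal_mul]
    exact (ihI hI0).mul (ihJ hJ0)

namespace IsPhiRing

variable {R : Type*} [CommRing R]

theorem comap_map_mk (hR : IsPhiRing R) {I : Ideal R} (hI : ¬I ≤ nilradical R) :
    (I.map (Ideal.Quotient.mk (nilradical R))).comap (Ideal.Quotient.mk (nilradical R)) = I := by
  rw [Ideal.comap_map_of_surjective _ Ideal.Quotient.mk_surjective, ← RingHom.ker_eq_comap_bot,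
    Ideal.mk_ker, sup_eq_left]
  exact (hR.2 I).resolve_left hI

theorem comap_mk_le_nilradical_iff {A : Ideal (R ⧸ nilradical R)} :
    A.comap (Ideal.Quotient.mk (nilradical R)) ≤ nilradical R ↔ A = ⊥ := by
  have h : nilradical R = (⊥ : Ideal (R ⧸ nilradical R)).comap (Ideal.Quotient.mk _) :=
    Ideal.mk_ker.symm
  exact (iff_of_eq (congrArg _ h)).trans ((Ideal.comap_le_comap_iff_of_surjective _
    Ideal.Quotient.mk_surjective A ⊥).trans le_bot_iff)

theorem comap_mk_mul (hR : IsPhiRing R) {A B : Ideal (R ⧸ nilradical R)} (hA : A ≠ ⊥)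
    (hB : B ≠ ⊥) :
    (A * B).comap (Ideal.Quotient.mk (nilradical R)) =
      A.comap (Ideal.Quotient.mk (nilradical R)) * B.comap (Ideal.Quotient.mk (nilradical R)) := by
  have hAB : ¬A.comap (Ideal.Quotient.mk (nilradical R)) *
      B.comap (Ideal.Quotient.mk (nilradical R)) ≤ nilradical R := by
    rw [hR.1.mul_le, comap_mk_le_nilradical_iff, comap_mk_le_nilradical_iff]
    tauto
  rw [← hR.comap_map_mk hAB, Ideal.map_mul,
    Ideal.map_comap_of_surjective _ Ideal.Quotient.mk_surjective,
    Ideal.map_comap_of_surjective _ Ideal.Quotient.mk_surjective]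

/-- Nonnil ideals of a φ-ring satisfy `(I ⊓ J) * K = I * K ⊓ J * K` if and only if the nonzero
ideals of its quotient by the nilradical do. -/
theorem inf_mul_iff (hR : IsPhiRing R) :
    (∀ I J K : Ideal R, ¬I ≤ nilradical R → ¬J ≤ nilradical R → ¬K ≤ nilradical R →
        (I ⊓ J) * K = (I * K) ⊓ (J * K)) ↔
      ∀ A B C : Ideal (R ⧸ nilradical R), A ≠ ⊥ → B ≠ ⊥ → C ≠ ⊥ →
        (A ⊓ B) * C = (A * C) ⊓ (B * C) := by
  have := hR.1
  have key (A B C : Ideal (R ⧸ nilradical R)) (hA : A ≠ ⊥) (hB : B ≠ ⊥) (hC : C ≠ ⊥) :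
      (A ⊓ B) * C = (A * C) ⊓ (B * C) ↔
        (A.comap (Ideal.Quotient.mk (nilradical R)) ⊓ B.comap (Ideal.Quotient.mk (nilradical R))) *
          C.comap (Ideal.Quotient.mk (nilradical R)) =
        A.comap (Ideal.Quotient.mk (nilradical R)) * C.comap (Ideal.Quotient.mk (nilradical R)) ⊓
        B.comap (Ideal.Quotient.mk (nilradical R)) *
          C.comap (Ideal.Quotient.mk (nilradical R)) := by
    have hAB : A ⊓ B ≠ ⊥ := fun h ↦
      mul_ne_zero hA hB (le_bot_iff.mp (Ideal.mul_le_inf.trans h.le))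
    rw [← Ideal.comap_inf, ← hR.comap_mk_mul hAB hC, ← hR.comap_mk_mul hA hC,
      ← hR.comap_mk_mul hB hC, ← Ideal.comap_inf,
      (Ideal.comap_injective_of_surjective _ Ideal.Quotient.mk_surjective).eq_iff]
  constructor
  · intro h A B C hA hB hC
    exact (key A B C hA hB hC).mpr (h _ _ _ (comap_mk_le_nilradical_iff.not.mpr hA)
      (comap_mk_le_nilradical_iff.not.mpr hB) (comap_mk_le_nilradical_iff.not.mpr hC))
  · intro h I J K hI hJ hK
    have hne {I : Ideal R} (hI : ¬I ≤ nilradical R) :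
        I.map (Ideal.Quotient.mk (nilradical R)) ≠ ⊥ := by
      rwa [ne_eq, ← comap_mk_le_nilradical_iff, hR.comap_map_mk hI]
    have := (key _ _ _ (hne hI) (hne hJ) (hne hK)).mp (h _ _ _ (hne hI) (hne hJ) (hne hK))
    rwa [hR.comap_map_mk hI, hR.comap_map_mk hJ, hR.comap_map_mk hK] at this

end IsPhiRing

theorem phiPrufer_iff_inf_mul (R : Type*) [CommRing R] (hR : IsPhiRing R) :
    IsPhiPrufer R ↔
      ∀ I J K : Ideal R, ¬I ≤ nilradical R → ¬J ≤ nilradical R → ¬K ≤ nilradical R →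
        (I ⊓ J) * K = (I * K) ⊓ (J * K) := by
  have := hR.1
  rw [hR.inf_mul_iff]
  constructor
  · intro h A B C _ _ _
    exact Ideal.inf_mul_of_forall_fg_isUnit
      (fun I hI hfg ↦ isUnit_iff_exists_inv.mpr (h I hI hfg)) A B C
  · intro h I hI hfg
    exact isUnit_iff_exists_inv.mp (Ideal.isUnit_of_forall_inf_mul h I hI hfg)
end

section
/- Let R be a φ-ring (a commutative ring whose nilradical Nil(R) is a divided prime ideal). Then R is a φ-Prüfer ring (equivalently, R/Nil(R) is a Prüfer domain) if and only if every finitely generated nonnil ideal I of R is locally principal, i.e., for every maximal ideal m of R the extension of I to the localization R_m is a principal ideal of R_m. -/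
open nonZeroDivisors in
/-- An ideal with an inverse fractional ideal is, away from any given proper ideal, generated by one
of its elements. -/
theorem Ideal.exists_mem_notMem_forall_dvd_mul_of_coeIdeal_mul_eq_one {D : Type*} [CommRing D]
    (K : Type*) [Field K] [Algebra D K] [IsFractionRing D K] {I : Ideal D}
    {J : FractionalIdeal D⁰ K} (h : (I : FractionalIdeal D⁰ K) * J = 1)
    {M : Ideal D} (hM : M ≠ ⊤) :
    ∃ a ∈ I, ∃ u ∉ M, ∀ b ∈ I, a ∣ u * b := by
  by_contra! H
  have hle : (I : FractionalIdeal D⁰ K) * J ≤ (M : FractionalIdeal D⁰ K) := by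
    refine FractionalIdeal.mul_le.2 fun i hi j hj => ?_
    obtain ⟨a, ha, rfl⟩ := (FractionalIdeal.mem_coeIdeal D⁰).1 hi
    have hmul : ∀ b ∈ I, ∃ d : D, algebraMap D K d = algebraMap D K b * j := fun b hb =>
      (FractionalIdeal.mem_one_iff D⁰).1
        (h ▸ FractionalIdeal.mul_mem_mul (FractionalIdeal.mem_coeIdeal_of_mem D⁰ hb) hj)
    obtain ⟨u, hu⟩ := hmul a ha
    rw [← hu]
    refine FractionalIdeal.mem_coeIdeal_of_mem D⁰ ?_
    by_contra hu_notMem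
    obtain ⟨b, hb, hab⟩ := H a ha u hu_notMem
    obtain ⟨d, hd⟩ := hmul b hb
    refine hab ⟨d, IsFractionRing.injective D K ?_⟩
    rw [map_mul, map_mul, hu, hd]
    ring
  rw [h] at hle
  obtain ⟨m, hm, hm1⟩ := (FractionalIdeal.mem_coeIdeal D⁰).1
    (hle (FractionalIdeal.one_mem_one D⁰))
  rw [← map_one (algebraMap D K)] at hm1
  exact hM ((Ideal.eq_top_iff_one M).2 (IsFractionRing.injective D K hm1 ▸ hm))

open nonZeroDivisors in
/-- A nonzero ideal that is locally generated by one of its elements has an inverse fractional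
ideal. -/
theorem Ideal.coeIdeal_mul_one_div_eq_one_of_forall_isMaximal {D : Type*} [CommRing D] [IsDomain D]
    (K : Type*) [Field K] [Algebra D K] [IsFractionRing D K] {I : Ideal D} (hI : I ≠ ⊥)
    (h : ∀ M : Ideal D, M.IsMaximal → ∃ a ∈ I, ∃ u ∉ M, ∀ b ∈ I, a ∣ u * b) :
    (I : FractionalIdeal D⁰ K) * (1 / (I : FractionalIdeal D⁰ K)) = 1 := by
  have hI0 : (I : FractionalIdeal D⁰ K) ≠ 0 := FractionalIdeal.coeIdeal_ne_zero.2 hI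
  have hle : (I : FractionalIdeal D⁰ K) * (1 / (I : FractionalIdeal D⁰ K)) ≤ 1 :=
    FractionalIdeal.mul_one_div_le_one
  obtain ⟨T, hT⟩ := FractionalIdeal.le_one_iff_exists_coeIdeal.1 hle
  rw [← hT]
  suffices hT_top : T = ⊤ by rw [hT_top, FractionalIdeal.coeIdeal_top]
  by_contra hT_top
  obtain ⟨M, hM, hTM⟩ := Ideal.exists_le_maximal T hT_top
  obtain ⟨a, ha, u, hu, hdvd⟩ := h M hM
  have ha0 : algebraMap D K a ≠ 0 := by
    rw [Ne, FaithfulSMul.algebraMap_eq_zero_iff]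
    rintro rfl
    obtain ⟨b, hb, hb0⟩ := Submodule.exists_mem_ne_zero_of_ne_bot hI
    rcases mul_eq_zero.1 (zero_dvd_iff.1 (hdvd b hb)) with h0 | h0
    · exact hu (h0 ▸ M.zero_mem)
    · exact hb0 h0
  have hinv : algebraMap D K u / algebraMap D K a ∈ 1 / (I : FractionalIdeal D⁰ K) := by
    refine (FractionalIdeal.mem_div_iff_of_ne_zero hI0).2 fun y hy => ?_
    obtain ⟨b, hb, rfl⟩ := (FractionalIdeal.mem_coeIdeal D⁰).1 hy
    obtain ⟨c, hc⟩ := hdvd b hb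
    refine (FractionalIdeal.mem_one_iff D⁰).2 ⟨c, ?_⟩
    rw [div_mul_eq_mul_div, eq_div_iff ha0, ← map_mul, ← map_mul, hc, mul_comm]
  have hmem := FractionalIdeal.mul_mem_mul (FractionalIdeal.mem_coeIdeal_of_mem D⁰ ha) hinv
  rw [mul_div_cancel₀ _ ha0, ← hT] at hmem
  obtain ⟨t, ht, htu⟩ := (FractionalIdeal.mem_coeIdeal D⁰).1 hmem
  exact hu (hTM (IsFractionRing.injective D K htu ▸ ht))

/-- A finitely generated ideal becomes principal in the localization at a prime if and only if some
element outside the prime multiplies it into the multiples of one of its elements. -/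
theorem Ideal.FG.isPrincipal_map_atPrime_iff {R : Type*} [CommRing R] {I : Ideal R} (hI : I.FG)
    (P : Ideal R) [P.IsPrime] :
    (I.map (algebraMap R (Localization.AtPrime P))).IsPrincipal ↔
      ∃ a ∈ I, ∃ u ∉ P, ∀ b ∈ I, a ∣ u * b := by
  constructor
  · rintro ⟨x, hx⟩
    rw [← Ideal.span] at hx
    have hxI : x ∈ I.map (algebraMap R (Localization.AtPrime P)) :=
      hx ▸ Ideal.mem_span_singleton_self x
    obtain ⟨⟨⟨a, ha⟩, s⟩, has⟩ := (IsLocalization.mem_map_algebraMap_iff P.primeCompl _).1 hxI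
    refine ⟨a, ha, ?_⟩
    have hloc : ∀ b ∈ I, ∃ t ∉ P, a ∣ t * b := by
      intro b hb
      have hbx := Ideal.mem_map_of_mem (algebraMap R (Localization.AtPrime P)) hb
      rw [hx, Ideal.mem_span_singleton] at hbx
      obtain ⟨y, hy⟩ := hbx
      obtain ⟨⟨r, t⟩, hrt⟩ := IsLocalization.surj P.primeCompl y
      obtain ⟨c, hc⟩ := (IsLocalization.eq_iff_exists P.primeCompl
        (Localization.AtPrime P)).1
        (show algebraMap R (Localization.AtPrime P) (s * t * b) = algebraMap R _ (a * r) by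
          simp only [map_mul] at has hrt ⊢
          rw [hy, ← has, ← hrt]
          ring)
      exact ⟨c * (s * t), (c * (s * t)).2, c * r, by linear_combination hc⟩
    obtain ⟨S, rfl⟩ := hI
    choose! t htP hta using hloc
    refine ⟨∏ b ∈ S, t b, ?_, fun b hb => ?_⟩
    · intro hmem
      obtain ⟨b, hb, hbP⟩ := Ideal.IsPrime.prod_mem_iff.1 hmem
      exact htP b (Ideal.subset_span hb) hbP
    · have hle : Ideal.span (S : Set R) ≤
          Submodule.comap (LinearMap.mulLeft R (∏ b ∈ S, t b)) (Ideal.span {a}) := by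
        refine Ideal.span_le.2 fun c hc => ?_
        refine Ideal.mem_span_singleton.2 ((hta c (Ideal.subset_span hc)).trans ?_)
        exact mul_dvd_mul_right (Finset.dvd_prod_of_mem t hc) c
      exact Ideal.mem_span_singleton.1 (hle hb)
  · rintro ⟨a, ha, u, hu, hdvd⟩
    refine ⟨algebraMap R _ a, le_antisymm ?_ ?_⟩
    · refine Ideal.map_le_iff_le_comap.2 fun b hb => Ideal.mem_span_singleton.2 ?_
      have hunit : IsUnit (algebraMap R (Localization.AtPrime P) u) :=
        IsLocalization.map_units (Localization.AtPrime P) (⟨u, hu⟩ : P.primeCompl)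
      rw [← hunit.dvd_mul_left, ← map_mul]
      exact map_dvd _ (hdvd b hb)
    · exact (Ideal.span_singleton_le_iff_mem _).2 (Ideal.mem_map_of_mem _ ha)

theorem phiPrufer_iff_fg_nonnil_locally_principal (R : Type*) [CommRing R]
    (hR : IsPhiRing R) :
    IsPhiPrufer R ↔
      ∀ I : Ideal R, ¬I ≤ nilradical R → I.FG →
        ∀ (M : Ideal R) (hM : M.IsMaximal),
          haveI := hM.isPrime
          (I.map (algebraMap R (Localization.AtPrime M))).IsPrincipal := by
  obtain ⟨hprime, hdiv⟩ := hR
  set π := Ideal.Quotient.mk (nilradical R) with hπ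
  have hπ_surj : Function.Surjective π := Ideal.Quotient.mk_surjective
  constructor
  · intro h I hI hfg M hM
    have := hM.isPrime
    have hker : RingHom.ker π ≤ M := by
      rw [hπ, Ideal.mk_ker]
      exact nilradical_le_prime M
    have hI0 : I.map π ≠ ⊥ := by
      rwa [Ne, Ideal.map_eq_bot_iff_le_ker, hπ, Ideal.mk_ker]
    have hcomap : (M.map π).comap π = M := by
      rw [Ideal.comap_map_of_surjective' π hπ_surj, sup_eq_left.2 hker]
    obtain ⟨J, hJ⟩ := h (I.map π) hI0 (hfg.map π)
    obtain ⟨a', ha', u', hu', hdvd⟩ :=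
      Ideal.exists_mem_notMem_forall_dvd_mul_of_coeIdeal_mul_eq_one _ hJ (M := M.map π) (by
        intro htop
        rw [htop, Ideal.comap_top] at hcomap
        exact hM.ne_top hcomap.symm)
    obtain ⟨a, ha, rfl⟩ := (Ideal.mem_map_iff_of_surjective π hπ_surj).1 ha'
    obtain ⟨u, rfl⟩ := hπ_surj u'
    have hu : u ∉ M := fun hu => hu' (Ideal.mem_map_of_mem π hu)
    have hlift : ∀ b ∈ I, ∃ c, u * b - a * c ∈ nilradical R := by
      intro b hb
      obtain ⟨c', hc'⟩ := hdvd (π b) (Ideal.mem_map_of_mem π hb)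
      obtain ⟨c, rfl⟩ := hπ_surj c'
      exact ⟨c, Ideal.Quotient.eq.1 (by simpa only [map_mul] using hc')⟩
    have hnil : nilradical R ≤ Ideal.span {a} := by
      refine (hdiv (Ideal.span {a})).resolve_left fun hle => hI fun b hb => ?_
      obtain ⟨c, hc⟩ := hlift b hb
      have hac := Ideal.mul_mem_right c _ (hle (Ideal.mem_span_singleton_self a))
      have hub : u * b ∈ nilradical R := by simpa using add_mem hc hac
      exact (hprime.mem_or_mem hub).resolve_left fun hun => hu (nilradical_le_prime M hun)
    refine (hfg.isPrincipal_map_atPrime_iff M).2 ⟨a, ha, u, hu, fun b hb => ?_⟩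
    obtain ⟨c, hc⟩ := hlift b hb
    exact (dvd_sub_left (dvd_mul_right a c)).1 (Ideal.mem_span_singleton.1 (hnil hc))
  · intro h I' hI' hfg'
    refine ⟨_, Ideal.coeIdeal_mul_one_div_eq_one_of_forall_isMaximal _ hI' fun M' hM' => ?_⟩
    obtain ⟨I, hfg, rfl⟩ : ∃ I : Ideal R, I.FG ∧ I.map π = I' := by
      classical
      obtain ⟨S, rfl⟩ := hfg'
      refine ⟨Ideal.span (S.image (Function.surjInv hπ_surj)), ⟨_, rfl⟩, ?_⟩
      rw [Ideal.map_span, Finset.coe_image, Set.image_image]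
      simp only [Function.surjInv_eq, Set.image_id']
    have hI : ¬I ≤ nilradical R := by
      rwa [Ne, Ideal.map_eq_bot_iff_le_ker, hπ, Ideal.mk_ker] at hI'
    have hM : (M'.comap π).IsMaximal := Ideal.comap_isMaximal_of_surjective π hπ_surj
    have := hM.isPrime
    obtain ⟨a, ha, u, hu, hdvd⟩ :=
      (hfg.isPrincipal_map_atPrime_iff (M'.comap π)).1 (h I hI hfg _ hM)
    refine ⟨π a, Ideal.mem_map_of_mem π ha, π u, hu, fun b' hb' => ?_⟩
    obtain ⟨b, hb, rfl⟩ := (Ideal.mem_map_iff_of_surjective π hπ_surj).1 hb'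
    rw [← map_mul]
    exact map_dvd π (hdvd b hb)
end

section
/- Let R be a φ-ring (a commutative ring whose nilradical Nil(R) is a divided prime ideal). Then R is a φ-Prüfer ring (equivalently, R/Nil(R) is a Prüfer domain) if and only if every non-nilpotent polynomial f ∈ R[X] is Gaussian, i.e., c(fg) = c(f)·c(g) for all g ∈ R[X], where c(h) denotes the content of h (the ideal of R generated by the coefficients of h). -/
section

open scoped Polynomial
open Polynomial hiding contentIdeal coeff_mem_contentIdeal

theorem coeff_mem_contentIdeal {R : Type*} [CommRing R] (f : R[X]) (n : ℕ) :
    f.coeff n ∈ contentIdeal f :=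
  Ideal.subset_span ⟨n, rfl⟩

theorem contentIdeal_eq_polynomial_contentIdeal {R : Type*} [CommRing R] (f : R[X]) :
    contentIdeal f = f.contentIdeal := by
  refine le_antisymm (Ideal.span_le.2 ?_) (Ideal.span_le.2 ?_)
  · rintro _ ⟨n, rfl⟩
    exact Polynomial.coeff_mem_contentIdeal f n
  · intro r hr
    obtain ⟨n, -, rfl⟩ := mem_coeffs_iff.1 (Finset.mem_coe.1 hr)
    exact coeff_mem_contentIdeal f n

theorem contentIdeal_map {R S : Type*} [CommRing R] [CommRing S] (φ : R →+* S) (f : R[X]) :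
    contentIdeal (f.map φ) = (contentIdeal f).map φ := by
  simp only [contentIdeal_eq_polynomial_contentIdeal, contentIdeal_map_eq_map_contentIdeal]

theorem contentIdeal_le_iff_mem_map_C {R : Type*} [CommRing R] {f : R[X]} {I : Ideal R} :
    contentIdeal f ≤ I ↔ f ∈ I.map (C : R →+* R[X]) := by
  rw [Ideal.mem_map_C_iff, contentIdeal, Ideal.span_le, Set.range_subset_iff]
  rfl

theorem exists_pow_coeff_mul_coeff_eq_zero {R : Type*} [CommRing R] {f g : R[X]}
    (hfg : f * g = 0) (i l : ℕ) : ∃ n : ℕ, f.coeff i ^ n * g.coeff l = 0 := by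
  let φ := algebraMap R (Localization.Away (f.coeff i))
  have hf : f.map φ ∈ nonZeroDivisors (Localization.Away (f.coeff i))[X] := by
    refine Polynomial.mem_nonZeroDivisors_iff.2 fun a ha => ?_
    have hu : IsUnit (φ (f.coeff i)) := IsLocalization.Away.algebraMap_isUnit _
    have := congrArg (fun p => p.coeff i) ha
    simp only [coeff_smul, coeff_map, coeff_zero, smul_eq_mul] at this
    exact hu.mul_left_eq_zero.1 this
  have hg : g.map φ = 0 := by
    refine (mul_left_mem_nonZeroDivisors_eq_zero_iff hf).1 ?_
    rw [← Polynomial.map_mul, hfg, Polynomial.map_zero]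
  have hl : φ (g.coeff l) = 0 := by rw [← coeff_map, hg, coeff_zero]
  obtain ⟨⟨_, n, rfl⟩, hn⟩ :=
    (IsLocalization.map_eq_zero_iff (Submonoid.powers (f.coeff i)) _ _).1 hl
  exact ⟨n, hn⟩

theorem exists_pow_coeff_mul_coeff_mem_contentIdeal {R : Type*} [CommRing R] (f g : R[X])
    (i l : ℕ) : ∃ n : ℕ, f.coeff i ^ n * g.coeff l ∈ contentIdeal (f * g) := by
  let π := Ideal.Quotient.mk (contentIdeal (f * g))
  have h : f.map π * g.map π = 0 := by
    ext n
    rw [← Polynomial.map_mul, coeff_map, coeff_zero]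
    exact Ideal.Quotient.eq_zero_iff_mem.2 (coeff_mem_contentIdeal _ n)
  obtain ⟨n, hn⟩ := exists_pow_coeff_mul_coeff_eq_zero h i l
  refine ⟨n, Ideal.Quotient.eq_zero_iff_mem.1 ?_⟩
  simpa only [coeff_map, map_mul, map_pow] using hn

/-- An invertible ideal is locally generated by one of any given family of generators. -/
theorem exists_notMem_forall_dvd_mul_of_invertible {D ι : Type*} [CommRing D] [IsDomain D]
    (a : ι → D) {J : FractionalIdeal (nonZeroDivisors D) (FractionRing D)}
    (hJ : (Ideal.span (Set.range a) : FractionalIdeal (nonZeroDivisors D) (FractionRing D)) * J = 1)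
    {M : Ideal D} (hM : M ≠ ⊤) : ∃ i, ∃ r ∉ M, ∀ k, a i ∣ r * a k := by
  have hmem : ∀ i, ∀ y ∈ J, ∃ r : D, algebraMap D (FractionRing D) r = algebraMap D _ (a i) * y := by
    intro i y hy
    rw [← FractionalIdeal.mem_one_iff (nonZeroDivisors D), ← hJ]
    exact FractionalIdeal.mul_mem_mul
      (FractionalIdeal.mem_coeIdeal_of_mem _ (Ideal.subset_span ⟨i, rfl⟩)) hy
  by_contra! hcon
  have key : ∀ i, ∀ y ∈ J, ∀ r : D,
      algebraMap D (FractionRing D) r = algebraMap D _ (a i) * y → r ∈ M := by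
    intro i y hy r hr
    by_contra hrM
    obtain ⟨k, hk⟩ := hcon i r hrM
    obtain ⟨t, ht⟩ := hmem k y hy
    refine hk ⟨t, IsFractionRing.injective D (FractionRing D) ?_⟩
    rw [map_mul, map_mul, hr, ht]
    ring
  have hle : (Ideal.span (Set.range a) : FractionalIdeal (nonZeroDivisors D) (FractionRing D)) * J
      ≤ (M : FractionalIdeal (nonZeroDivisors D) (FractionRing D)) := by
    rw [FractionalIdeal.mul_le]
    intro x hx y hy
    obtain ⟨x, hx', rfl⟩ := (FractionalIdeal.mem_coeIdeal _).1 hx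
    clear hx
    induction hx' using Submodule.span_induction with
    | mem x hx =>
      obtain ⟨i, rfl⟩ := hx
      obtain ⟨r, hr⟩ := hmem i y hy
      rw [← hr]
      exact FractionalIdeal.mem_coeIdeal_of_mem _ (key i y hy r hr)
    | zero => simp
    | add x z _ _ hx hz =>
      rw [map_add, add_mul]
      exact Submodule.add_mem _ hx hz
    | smul c x _ hx =>
      rw [smul_eq_mul, map_mul, mul_assoc, ← Algebra.smul_def]
      exact Submodule.smul_mem _ c hx
  rw [hJ, ← FractionalIdeal.coeIdeal_top, FractionalIdeal.coeIdeal_le_coeIdeal] at hle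
  exact hM (top_le_iff.1 hle)

theorem IsPhiRing.exists_notMem_mul_coeff_mul_coeff_mem {R : Type*} [CommRing R]
    (hR : IsPhiRing R) (hP : IsPhiPrufer R) {f : R[X]} (hf : ¬IsNilpotent f) (g : R[X])
    (k l : ℕ) {M : Ideal R} (hM : M.IsPrime) :
    ∃ r ∉ M, r * (f.coeff k * g.coeff l) ∈ contentIdeal (f * g) := by
  have : (nilradical R).IsPrime := hR.1
  let π := Ideal.Quotient.mk (nilradical R)
  have hNM : nilradical R ≤ M := nilradical_le_prime M
  have hfπ : contentIdeal (f.map π) ≠ ⊥ := by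
    contrapose! hf
    rw [Polynomial.isNilpotent_iff]
    intro n
    rw [← mem_nilradical, ← Ideal.Quotient.eq_zero_iff_mem, ← coeff_map, ← Ideal.mem_bot, ← hf]
    exact coeff_mem_contentIdeal _ n
  obtain ⟨J, hJ⟩ := hP _ hfπ (by
    rw [contentIdeal_eq_polynomial_contentIdeal]
    exact contentIdeal_FG _)
  have hcomap : (M.map π).comap π = M := Ideal.comap_map_mk hNM
  have hMπ : M.map π ≠ ⊤ := by
    intro h
    rw [h, Ideal.comap_top] at hcomap
    exact hM.ne_top hcomap.symm
  obtain ⟨i, r, hr, hdvd⟩ := exists_notMem_forall_dvd_mul_of_invertible _ hJ hMπ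
  obtain ⟨s, rfl⟩ := Ideal.Quotient.mk_surjective r
  have hs : s ∉ M := fun h => hr (Ideal.mem_map_of_mem π h)
  have hfi : f.coeff i ∉ nilradical R := by
    intro h
    refine hf (Polynomial.isNilpotent_iff.2 fun n => ?_)
    have hd := hdvd n
    rw [coeff_map, coeff_map, Ideal.Quotient.eq_zero_iff_mem.2 h, zero_dvd_iff, ← map_mul,
      Ideal.Quotient.eq_zero_iff_mem] at hd
    exact (hR.1.mem_or_mem hd).resolve_left fun hsN => hs (hNM hsN)
  have hle : nilradical R ≤ Ideal.span {f.coeff i} :=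
    (hR.2 _).resolve_left fun h => hfi (h (Ideal.mem_span_singleton_self _))
  have hC : C (f.coeff i) ∣ C s * f := by
    rw [C_dvd_iff_dvd_coeff]
    intro n
    obtain ⟨t, ht⟩ := hdvd n
    obtain ⟨t, rfl⟩ := Ideal.Quotient.mk_surjective t
    rw [coeff_map, coeff_map, ← map_mul, ← map_mul, Ideal.Quotient.eq] at ht
    rw [coeff_C_mul, ← Ideal.mem_span_singleton]
    simpa using add_mem (hle ht)
      (Ideal.mul_mem_right t _ (Ideal.mem_span_singleton_self (f.coeff i)))
  obtain ⟨h, hh⟩ := hC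
  have hcoeff : ∀ n, s * f.coeff n = f.coeff i * h.coeff n := fun n => by
    rw [← coeff_C_mul, hh, coeff_C_mul]
  have hhi : h.coeff i ∉ M := by
    intro hmem
    have h0 : f.coeff i * (s - h.coeff i) ∈ nilradical R := by
      convert zero_mem (nilradical R) using 1
      linear_combination hcoeff i
    have h1 := hNM ((hR.1.mem_or_mem h0).resolve_left hfi)
    exact hs (by simpa using add_mem h1 hmem)
  obtain ⟨n, hn⟩ := exists_pow_coeff_mul_coeff_mem_contentIdeal h g i l
  have hsub : ∀ x ∈ contentIdeal (h * g), f.coeff i * x ∈ contentIdeal (f * g) := by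
    intro x hx
    induction hx using Submodule.span_induction with
    | mem x hx =>
      obtain ⟨m, rfl⟩ := hx
      rw [← coeff_C_mul, ← mul_assoc, ← hh, mul_assoc, coeff_C_mul]
      exact Ideal.mul_mem_left _ _ (coeff_mem_contentIdeal _ m)
    | zero => simp
    | add x y _ _ hx hy =>
      rw [mul_add]
      exact add_mem hx hy
    | smul c x _ hx =>
      rw [smul_eq_mul, mul_left_comm]
      exact Ideal.mul_mem_left _ c hx
  refine ⟨h.coeff i ^ n * s, hM.mul_notMem (fun hm => hhi (hM.mem_of_pow_mem n hm)) hs, ?_⟩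
  convert Ideal.mul_mem_left _ (h.coeff k) (hsub _ hn) using 1
  linear_combination (h.coeff i ^ n * g.coeff l) * hcoeff k

/-- The ideal `I` is principal, up to multiplying by an element outside `M`. -/
def Ideal.IsPrincipalAt {D : Type*} [CommRing D] (I M : Ideal D) : Prop :=
  ∃ a ∈ I, ∃ r ∉ M, ∀ x ∈ I, a ∣ r * x

theorem Ideal.IsPrincipalAt.sup {D : Type*} [CommRing D] {I J M : Ideal D} (hM : M.IsPrime)
    (hcomp : ∀ a b : D, ∃ r ∉ M, a ∣ r * b ∨ b ∣ r * a)
    (hI : I.IsPrincipalAt M) (hJ : J.IsPrincipalAt M) : (I ⊔ J).IsPrincipalAt M := by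
  obtain ⟨a, haI, r, hr, har⟩ := hI
  obtain ⟨b, hbJ, s, hs, hbs⟩ := hJ
  obtain ⟨t, ht, hab | hba⟩ := hcomp a b
  · refine ⟨a, Ideal.mem_sup_left haI, t * s * r,
      hM.mul_notMem (hM.mul_notMem ht hs) hr, fun x hx => ?_⟩
    obtain ⟨y, hy, z, hz, rfl⟩ := Submodule.mem_sup.1 hx
    have h1 : a ∣ t * s * (r * y) := (har y hy).mul_left _
    have h2 : a ∣ r * (t * (s * z)) :=
      (hab.trans (mul_dvd_mul_left t (hbs z hz))).mul_left r
    convert dvd_add h1 h2 using 1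
    ring
  · refine ⟨b, Ideal.mem_sup_right hbJ, t * s * r,
      hM.mul_notMem (hM.mul_notMem ht hs) hr, fun x hx => ?_⟩
    obtain ⟨y, hy, z, hz, rfl⟩ := Submodule.mem_sup.1 hx
    have h1 : b ∣ s * (t * (r * y)) :=
      (hba.trans (mul_dvd_mul_left t (har y hy))).mul_left s
    have h2 : b ∣ t * r * (s * z) := (hbs z hz).mul_left _
    convert dvd_add h1 h2 using 1
    ring

theorem Ideal.FG.isPrincipalAt {D : Type*} [CommRing D] {I M : Ideal D} (hI : I.FG)
    (hM : M.IsPrime) (hcomp : ∀ a b : D, ∃ r ∉ M, a ∣ r * b ∨ b ∣ r * a) :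
    I.IsPrincipalAt M := by
  induction I, hI using Submodule.fg_induction with
  | singleton x =>
    refine ⟨x, Submodule.mem_span_singleton_self x, 1, hM.one_notMem, fun y hy => ?_⟩
    rw [one_mul]
    exact Ideal.mem_span_singleton.1 hy
  | sup I J _ _ hI hJ => exact hI.sup hM hcomp hJ

theorem exists_mul_eq_one_of_isPrincipalAt {D : Type*} [CommRing D] [IsDomain D] {I : Ideal D}
    (hI : I ≠ ⊥) (h : ∀ M : Ideal D, M.IsMaximal → I.IsPrincipalAt M) :
    ∃ J : FractionalIdeal (nonZeroDivisors D) (FractionRing D),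
      (I : FractionalIdeal (nonZeroDivisors D) (FractionRing D)) * J = 1 := by
  obtain ⟨d, hdI, hd⟩ := Submodule.exists_mem_ne_zero_of_ne_bot hI
  let J : Ideal D := (Ideal.span {d}).colon I
  have hmemJ : ∀ {y}, y ∈ J ↔ ∀ x ∈ I, d ∣ y * x := by
    intro y
    simp [J, Submodule.mem_colon, Ideal.mem_span_singleton]
  have hIJ : I * J = Ideal.span {d} := by
    refine le_antisymm (Ideal.mul_le.2 fun x hx y hy => ?_) ?_
    · rw [Ideal.mem_span_singleton, mul_comm]
      exact hmemJ.1 hy x hx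
    · rw [Ideal.span_singleton_le_iff_mem]
      suffices (I * J).colon {d} = ⊤ by
        have h1 : (1 : D) ∈ (I * J).colon {d} := this ▸ Submodule.mem_top
        simpa [Submodule.mem_colon_singleton] using h1
      by_contra hne
      obtain ⟨M, hM, hle⟩ := Ideal.exists_le_maximal _ hne
      obtain ⟨a, haI, r, hr, har⟩ := h M hM
      refine hr (hle ?_)
      rw [Submodule.mem_colon_singleton, smul_eq_mul]
      obtain ⟨t, ht⟩ := har d hdI
      rw [ht]
      refine Ideal.mul_mem_mul haI (hmemJ.2 fun x hx => ?_)
      obtain ⟨z, hz⟩ := har x hx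
      rcases eq_or_ne a 0 with rfl | ha
      · rw [zero_mul] at ht
        rcases mul_eq_zero.1 ht with rfl | h0
        · exact absurd (zero_mem M) hr
        · exact absurd h0 hd
      · refine ⟨z, mul_left_cancel₀ ha ?_⟩
        linear_combination (-x) * ht + d * hz
  have hd' : algebraMap D (FractionRing D) d ≠ 0 := by simpa using hd
  refine ⟨(J : FractionalIdeal (nonZeroDivisors D) (FractionRing D)) *
    FractionalIdeal.spanSingleton _ (algebraMap D (FractionRing D) d)⁻¹, ?_⟩
  rw [← mul_assoc, ← FractionalIdeal.coeIdeal_mul, hIJ, FractionalIdeal.coeIdeal_span_singleton,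
    FractionalIdeal.spanSingleton_mul_spanSingleton, mul_inv_cancel₀ hd',
    FractionalIdeal.spanSingleton_one]

theorem exists_notMem_dvd_mul_or_of_gaussian {D : Type*} [CommRing D] [IsDomain D]
    (hG : ∀ f : D[X], f ≠ 0 → ∀ g : D[X], contentIdeal (f * g) = contentIdeal f * contentIdeal g)
    {M : Ideal D} (hM : M ≠ ⊤) (a b : D) : ∃ r ∉ M, a ∣ r * b ∨ b ∣ r * a := by
  rcases eq_or_ne a 0 with rfl | ha
  · exact ⟨1, fun h => hM ((Ideal.eq_top_iff_one M).2 h), Or.inr (by simp)⟩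
  have linear_mem : ∀ p q u v : D, p ≠ 0 → ∀ I : Ideal D, p * u ∈ I → p * v + q * u ∈ I →
      q * v ∈ I → q * u ∈ I := by
    intro p q u v hp I h2 h1 h0
    have hne : C p * X + C q ≠ 0 := fun h => hp (by simpa using congrArg (fun f => f.coeff 1) h)
    have hle : contentIdeal ((C p * X + C q) * (C u * X + C v)) ≤ I := by
      rw [contentIdeal_le_iff_mem_map_C]
      have : (C p * X + C q) * (C u * X + C v) =
          C (p * u) * X ^ 2 + C (p * v + q * u) * X + C (q * v) := by
        simp only [map_mul, map_add]
        ring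
      rw [this]
      exact add_mem (add_mem (Ideal.mul_mem_right _ _ (Ideal.mem_map_of_mem C h2))
        (Ideal.mul_mem_right _ _ (Ideal.mem_map_of_mem C h1))) (Ideal.mem_map_of_mem C h0)
    rw [hG _ hne] at hle
    refine hle (Ideal.mul_mem_mul ?_ ?_)
    · convert coeff_mem_contentIdeal (C p * X + C q) 0 using 1
      simp
    · convert coeff_mem_contentIdeal (C u * X + C v) 1 using 1
      simp
  have hab : b * a ∈ Ideal.span {a ^ 2, b ^ 2} := by
    refine linear_mem a b a (-b) ha _ ?_ ?_ ?_
    · exact Ideal.subset_span (by simp [sq])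
    · convert zero_mem (Ideal.span {a ^ 2, b ^ 2}) using 1
      ring
    · rw [mul_neg, ← sq]
      exact neg_mem (Ideal.subset_span (by simp))
  obtain ⟨x, y, hxy⟩ := Ideal.mem_span_pair.1 hab
  have hy : -b * (y * a) ∈ Ideal.span {a ^ 2} := by
    refine linear_mem a (-b) (y * a) (y * b - a) ha _ ?_ ?_ ?_ <;> rw [Ideal.mem_span_singleton]
    · exact ⟨y, by ring⟩
    · exact ⟨-1, by ring⟩
    · exact ⟨x, by linear_combination -hxy⟩
  obtain ⟨w, hw⟩ := Ideal.mem_span_singleton.1 hy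
  have hw' : w * a = b * (-y) := mul_left_cancel₀ ha (by linear_combination -hw)
  have hx : (1 + w) * b = a * x := mul_left_cancel₀ ha (by linear_combination -hxy + b * hw')
  by_cases hwM : w ∈ M
  · refine ⟨1 + w, fun h => hM ((Ideal.eq_top_iff_one M).2 ?_), Or.inl ⟨x, hx⟩⟩
    simpa using sub_mem h hwM
  · exact ⟨w, hwM, Or.inr ⟨-y, hw'⟩⟩

end

theorem phiPrufer_iff_nonnilpotent_poly_gaussian (R : Type*) [CommRing R]
    (hR : IsPhiRing R) :
    IsPhiPrufer R ↔
      ∀ f : Polynomial R, ¬IsNilpotent f →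
        ∀ g : Polynomial R, contentIdeal (f * g) = contentIdeal f * contentIdeal g := by
  have : (nilradical R).IsPrime := hR.1
  constructor
  · intro hP f hf g
    refine le_antisymm ?_ ?_
    · simp only [contentIdeal_eq_polynomial_contentIdeal]
      exact Polynomial.contentIdeal_mul_le_mul_contentIdeal f g
    · rw [contentIdeal, contentIdeal, Ideal.span_mul_span', Ideal.span_le]
      rintro _ ⟨_, ⟨k, rfl⟩, _, ⟨l, rfl⟩, rfl⟩
      suffices (contentIdeal (f * g)).colon {f.coeff k * g.coeff l} = ⊤ by
        have h1 : (1 : R) ∈ (contentIdeal (f * g)).colon {f.coeff k * g.coeff l} :=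
          this ▸ Submodule.mem_top
        simpa [Submodule.mem_colon_singleton] using h1
      by_contra hne
      obtain ⟨M, hM, hle⟩ := Ideal.exists_le_maximal _ hne
      obtain ⟨r, hr, hmem⟩ := hR.exists_notMem_mul_coeff_mul_coeff_mem hP hf g k l hM.isPrime
      exact hr (hle (Submodule.mem_colon_singleton.2 hmem))
  · intro h I hI hfg
    let π := Ideal.Quotient.mk (nilradical R)
    refine exists_mul_eq_one_of_isPrincipalAt hI fun M hM => hfg.isPrincipalAt hM.isPrime
      (exists_notMem_dvd_mul_or_of_gaussian (fun f hf g => ?_) hM.ne_top)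
    obtain ⟨f, rfl⟩ := Polynomial.map_surjective π Ideal.Quotient.mk_surjective f
    obtain ⟨g, rfl⟩ := Polynomial.map_surjective π Ideal.Quotient.mk_surjective g
    rw [← Polynomial.map_mul]
    simp only [contentIdeal_map]
    rw [h f (fun hn => hf (hn.map (Polynomial.mapRingHom π)).eq_zero), Ideal.map_mul]
end

section
/- Let R be a φ-ring (a commutative ring whose nilradical Nil(R) is a divided prime ideal). If R is a Gaussian ring, i.e., c(fg) = c(f)·c(g) for all f, g ∈ R[X], then R is a φ-Prüfer ring, i.e., R/Nil(R) is a Prüfer domain. -/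
open Polynomial (C X C_mul C_add coeff_add coeff_C_mul coeff_X coeff_C coeff_X_pow) in
/-- In a Gaussian ring, the content formula for `(a + bX)(c + dX)` expresses `ad` through the
coefficients of the product. -/
theorem exists_mul_eq_of_contentIdeal_mul {R : Type*} [CommRing R]
    (hGauss : ∀ f g : Polynomial R, contentIdeal (f * g) = contentIdeal f * contentIdeal g)
    (a b c d : R) :
    ∃ x y z : R, a * d = x * (a * c) + y * (a * d + b * c) + z * (b * d) := by
  have hmem : a * d ∈ contentIdeal ((C a + C b * X) * (C c + C d * X)) := by
    rw [hGauss]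
    refine Ideal.mul_mem_mul (Ideal.subset_span ⟨0, ?_⟩) (Ideal.subset_span ⟨1, ?_⟩) <;> simp
  have hle : contentIdeal ((C a + C b * X) * (C c + C d * X)) ≤
      Ideal.span {a * c, a * d + b * c, b * d} := by
    refine Ideal.span_le.2 ?_
    rintro _ ⟨n, rfl⟩
    have hprod : (C a + C b * X) * (C c + C d * X) =
        C (a * c) + C (a * d + b * c) * X + C (b * d) * X ^ 2 := by
      simp only [C_mul, C_add]; ring
    rw [hprod]
    simp only [coeff_add, coeff_C_mul, coeff_C, coeff_X, coeff_X_pow]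
    match n with
    | 0 => exact Ideal.subset_span (by simp)
    | 1 => exact Ideal.subset_span (by simp)
    | 2 => exact Ideal.subset_span (by simp)
    | n + 3 => simp
  obtain ⟨x, u, hu, h⟩ := Ideal.mem_span_insert.1 (hle hmem)
  obtain ⟨y, z, rfl⟩ := Ideal.mem_span_pair.1 hu
  exact ⟨x, y, z, by linear_combination h⟩

namespace Ideal

/-- An ideal dividing a nonzero principal ideal; in a domain, these are the invertible ideals. -/
def DividesPrincipal {D : Type*} [CommRing D] (I : Ideal D) : Prop :=
  ∃ (J : Ideal D) (c : D), c ≠ 0 ∧ I * J = span {c}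

variable {D : Type*} [CommRing D]

theorem DividesPrincipal.mul [IsDomain D] {I J : Ideal D} (hI : I.DividesPrincipal)
    (hJ : J.DividesPrincipal) : (I * J).DividesPrincipal := by
  obtain ⟨I', c, hc, h⟩ := hI
  obtain ⟨J', d, hd, h'⟩ := hJ
  exact ⟨I' * J', c * d, mul_ne_zero hc hd, by
    rw [mul_mul_mul_comm, h, h', span_singleton_mul_span_singleton]⟩

theorem DividesPrincipal.of_mul_left {I J : Ideal D} (h : (I * J).DividesPrincipal) :
    I.DividesPrincipal := by
  obtain ⟨K, c, hc, h⟩ := h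
  exact ⟨J * K, c, hc, by rw [← mul_assoc, h]⟩

theorem dividesPrincipal_span_singleton {a : D} (ha : a ≠ 0) : (span {a}).DividesPrincipal :=
  ⟨⊤, a, ha, mul_top _⟩

theorem sup_mul_sup_mul_sup (A B C : Ideal D) :
    (A ⊔ B) * (B ⊔ C) * (C ⊔ A) = (A ⊔ B ⊔ C) * (A * B ⊔ B * C ⊔ C * A) := by
  have h : A * B * C ≤ (A ⊔ B) * (B ⊔ C) * (C ⊔ A) :=
    mul_mono (mul_mono le_sup_left le_sup_left) le_sup_left
  rw [← sup_eq_left.2 h]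
  simp only [← Submodule.add_eq_sup]
  ring

theorem DividesPrincipal.sup_sup [IsDomain D] {A B C : Ideal D} (hAB : (A ⊔ B).DividesPrincipal)
    (hBC : (B ⊔ C).DividesPrincipal) (hCA : (C ⊔ A).DividesPrincipal) :
    (A ⊔ B ⊔ C).DividesPrincipal :=
  .of_mul_left (sup_mul_sup_mul_sup A B C ▸ (hAB.mul hBC).mul hCA)

theorem dividesPrincipal_span_of_pair [IsDomain D]
    (h : ∀ a b : D, a ≠ 0 → (span {a, b}).DividesPrincipal) (s : Finset D) :
    span (s : Set D) ≠ ⊥ → (span (s : Set D)).DividesPrincipal := by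
  classical
  induction hn : s.card using Nat.strong_induction_on generalizing s with
  | _ n ih =>
  subst hn
  intro hs
  by_cases h0 : (0 : D) ∈ s
  · have heq : span ((s.erase 0 : Finset D) : Set D) = span (s : Set D) := by
      rw [Finset.coe_erase, span_sdiff_singleton_zero]
    rw [← heq] at hs ⊢
    exact ih _ (Finset.card_erase_lt_of_mem h0) _ rfl hs
  · have hne : ∀ a ∈ s, a ≠ 0 := fun a ha h => h0 (h ▸ ha)
    obtain rfl | ⟨a, ha⟩ := s.eq_empty_or_nonempty
    · simp at hs
    obtain ⟨t, hat, rfl⟩ : ∃ t, a ∉ t ∧ insert a t = s :=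
      ⟨s.erase a, by simp, Finset.insert_erase ha⟩
    obtain rfl | ⟨b, hb⟩ := t.eq_empty_or_nonempty
    · simpa using dividesPrincipal_span_singleton (hne a ha)
    obtain ⟨u, hbu, rfl⟩ : ∃ u, b ∉ u ∧ insert b u = t :=
      ⟨t.erase b, by simp, Finset.insert_erase hb⟩
    obtain rfl | ⟨c, hc⟩ := u.eq_empty_or_nonempty
    · simpa using h a b (hne a ha)
    have hspan : span ((insert a (insert b u) : Finset D) : Set D) =
        span {a} ⊔ span {b} ⊔ span (u : Set D) := by
      rw [Finset.coe_insert, Finset.coe_insert, span_insert, span_insert, sup_assoc]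
    have hau : a ∉ u := fun h => hat (Finset.mem_insert_of_mem h)
    have key : ∀ x ∈ insert a (insert b u), x ∉ u →
        (span {x} ⊔ span (u : Set D)).DividesPrincipal := by
      intro x hx hxu
      rw [← span_insert, ← Finset.coe_insert]
      refine ih _ ?_ _ rfl fun hbot => hne x hx ?_
      · rw [Finset.card_insert_of_notMem hxu, Finset.card_insert_of_notMem hat,
          Finset.card_insert_of_notMem hbu]
        omega
      · exact span_eq_bot.1 hbot x (by simp)
    rw [hspan]
    refine .sup_sup ?_ (key b (by simp) hbu) ?_
    · rw [← span_insert]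
      exact h a b (hne a ha)
    · rw [sup_comm]
      exact key a ha hau

theorem dividesPrincipal_span_pair [IsDomain D]
    (h : ∀ a b c d : D, ∃ x y z : D, a * d = x * (a * c) + y * (a * d + b * c) + z * (b * d))
    {a : D} (ha : a ≠ 0) (b : D) : (span {a, b}).DividesPrincipal := by
  obtain ⟨x, y, hxy⟩ : ∃ x y : D, a * b = x * a ^ 2 + y * b ^ 2 := by
    obtain ⟨x, y, z, e⟩ := h a b a (-b)
    exact ⟨-x, z, by linear_combination -e⟩
  -- `y * b / a` is a root of `T ^ 2 - T + x * y`.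
  obtain ⟨w, hw⟩ : ∃ w : D, y * b = a * w := by
    obtain ⟨r, s, t, e⟩ := h (-(y * b)) a (-(a - y * b)) a
    refine ⟨-(r * (x * y) - s + t), mul_left_cancel₀ ha ?_⟩
    linear_combination -e - r * y * hxy
  have hw' : b * (1 - w) = a * x :=
    mul_left_cancel₀ ha (by linear_combination hxy + b * hw)
  refine ⟨span {y, 1 - w}, a, ha, ?_⟩
  rw [span_pair_mul_span_pair]
  apply le_antisymm
  · rw [span_le]
    rintro _ (rfl | rfl | rfl | rfl) <;> rw [SetLike.mem_coe, mem_span_singleton]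
    · exact ⟨y, rfl⟩
    · exact ⟨1 - w, rfl⟩
    · exact ⟨w, by linear_combination hw⟩
    · exact ⟨x, hw'⟩
  · rw [span_singleton_le_iff_mem]
    have hmem : a * (1 - w) + b * y ∈ span {a * y, a * (1 - w), b * y, b * (1 - w)} :=
      add_mem (subset_span (by simp)) (subset_span (by simp))
    rwa [show a * (1 - w) + b * y = a by linear_combination hw] at hmem

theorem DividesPrincipal.exists_fractionalIdeal_mul_eq_one [IsDomain D] {I : Ideal D}
    (hI : I.DividesPrincipal) (K : Type*) [Field K] [Algebra D K] [IsFractionRing D K] :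
    ∃ J : FractionalIdeal (nonZeroDivisors D) K,
      (I : FractionalIdeal (nonZeroDivisors D) K) * J = 1 := by
  obtain ⟨J, c, hc, h⟩ := hI
  have hc' : algebraMap D K c ≠ 0 := by simpa using hc
  refine ⟨(J : FractionalIdeal (nonZeroDivisors D) K) *
    FractionalIdeal.spanSingleton _ (algebraMap D K c)⁻¹, ?_⟩
  rw [← mul_assoc, ← FractionalIdeal.coeIdeal_mul, h, FractionalIdeal.coeIdeal_span_singleton,
    FractionalIdeal.spanSingleton_mul_spanSingleton, mul_inv_cancel₀ hc',
    FractionalIdeal.spanSingleton_one]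

end Ideal

theorem phiPrufer_of_gaussian (R : Type*) [CommRing R] (hR : IsPhiRing R)
    (hGauss : ∀ f g : Polynomial R,
      contentIdeal (f * g) = contentIdeal f * contentIdeal g) :
    IsPhiPrufer R := by
  have := hR.1
  have hD : ∀ a b c d : R ⧸ nilradical R, ∃ x y z : R ⧸ nilradical R,
      a * d = x * (a * c) + y * (a * d + b * c) + z * (b * d) := by
    intro a b c d
    obtain ⟨a, rfl⟩ := Ideal.Quotient.mk_surjective a
    obtain ⟨b, rfl⟩ := Ideal.Quotient.mk_surjective b
    obtain ⟨c, rfl⟩ := Ideal.Quotient.mk_surjective c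
    obtain ⟨d, rfl⟩ := Ideal.Quotient.mk_surjective d
    obtain ⟨x, y, z, e⟩ := exists_mul_eq_of_contentIdeal_mul hGauss a b c d
    exact ⟨Ideal.Quotient.mk _ x, Ideal.Quotient.mk _ y, Ideal.Quotient.mk _ z, by
      simpa only [map_mul, map_add] using congrArg (Ideal.Quotient.mk (nilradical R)) e⟩
  rintro _ hI ⟨s, rfl⟩
  exact (Ideal.dividesPrincipal_span_of_pair
    (fun _ b ha => Ideal.dividesPrincipal_span_pair hD ha b) s hI).exists_fractionalIdeal_mul_eq_one _
end

section
/- Let R be a φ-ring (a commutative ring whose nilradical Nil(R) is a divided prime ideal) and let f ∈ R[X] be a non-nilpotent polynomial. Then the content c(f) of f equals the ideal of R generated by the non-nilpotent coefficients of f; equivalently, c(f) = c(f̃), where f̃ is the polynomial obtained from f by replacing every nilpotent coefficient by 0. -/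
theorem contentIdeal_eq_span_nonnilpotent_coeffs (R : Type*) [CommRing R]
    (hR : IsPhiRing R) (f : Polynomial R) (hf : ¬IsNilpotent f) :
    contentIdeal f =
      Ideal.span {a : R | a ∈ Set.range f.coeff ∧ ¬IsNilpotent a} := by
  obtain ⟨i, hi⟩ : ∃ i, ¬IsNilpotent (f.coeff i) := by
    contrapose! hf
    exact Polynomial.isNilpotent_iff.mpr hf
  have hmem : f.coeff i ∈ Ideal.span {a : R | a ∈ Set.range f.coeff ∧ ¬IsNilpotent a} :=
    Ideal.subset_span ⟨⟨i, rfl⟩, hi⟩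
  have hnil : nilradical R ≤ Ideal.span {a : R | a ∈ Set.range f.coeff ∧ ¬IsNilpotent a} :=
    (hR.2 _).resolve_left fun h => hi (mem_nilradical.mp (h hmem))
  refine le_antisymm (Ideal.span_le.mpr fun a ha => ?_) (Ideal.span_mono fun a ha => ha.1)
  by_cases hn : IsNilpotent a
  · exact hnil (mem_nilradical.mpr hn)
  · exact Ideal.subset_span ⟨ha, hn⟩
end

section
/- Let R be a φ-ring (a commutative ring whose nilradical Nil(R) is a divided prime ideal). Then R is a φ-Prüfer ring (equivalently, R/Nil(R) is a Prüfer domain) and Z(R) = Nil(R) (every zerodivisor of R is nilpotent) if and only if R is nonnil-semihereditary, i.e., every finitely generated nonnil ideal of R is projective as an R-module. -/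
open scoped nonZeroDivisors

theorem Ideal.projective_of_mul_eq_span_singleton {R : Type*} [CommRing R] {I J : Ideal R} {a : R}
    (ha : a ∈ R⁰) (h : I * J = Ideal.span {a}) : Module.Projective R I := by
  let A := FractionRing R
  have hinj : Function.Injective (Algebra.linearMap R A) := IsFractionRing.injective R A
  have hunit : IsUnit (IsLocalization.coeSubmodule A I) := by
    refine IsUnit.of_mul_eq_one
      (IsLocalization.coeSubmodule A J * Submodule.span R {IsLocalization.mk' A 1 ⟨a, ha⟩}) ?_
    rw [← mul_assoc, ← IsLocalization.coeSubmodule_mul, h,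
      IsLocalization.coeSubmodule_span_singleton, Submodule.span_mul_span,
      Set.singleton_mul_singleton, IsLocalization.mk'_spec' A 1 ⟨a, ha⟩, map_one,
      Submodule.one_eq_span]
  have : Module.Projective R (Submodule.map (Algebra.linearMap R A) I) :=
    Submodule.projective_of_isUnit hunit
  exact Module.Projective.of_equiv (Submodule.equivMapOfInjective _ hinj I).symm

theorem Ideal.exists_mul_eq_span_singleton_of_projective {R : Type*} [CommRing R] {I : Ideal R}
    [Module.Projective R I] {a : R} (ha : a ∈ I) : ∃ J : Ideal R, I * J = Ideal.span {a} := by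
  obtain ⟨s, hs⟩ := Module.projective_def'.mp ‹Module.Projective R I›
  refine ⟨Ideal.span (Set.range (s ⟨a, ha⟩)), le_antisymm ?_ ?_⟩
  · rw [Ideal.mul_le]
    intro x hx y hy
    induction hy using Submodule.span_induction with
    | mem y hy =>
      obtain ⟨i, rfl⟩ := hy
      rw [Ideal.mem_span_singleton]
      have hsmul : x • (⟨a, ha⟩ : I) = a • ⟨x, hx⟩ := Subtype.ext (mul_comm x a)
      have := DFunLike.congr_fun (congrArg s hsmul) i
      rw [map_smul, map_smul, Finsupp.smul_apply, Finsupp.smul_apply, smul_eq_mul,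
        smul_eq_mul] at this
      exact ⟨_, this⟩
    | zero => simp
    | add y z _ _ hy hz => rw [mul_add]; exact add_mem hy hz
    | smul r y _ hy => rw [smul_eq_mul, mul_left_comm]; exact Ideal.mul_mem_left _ _ hy
  · rw [Ideal.span_singleton_le_iff_mem]
    have h := congrArg Subtype.val (DFunLike.congr_fun hs ⟨a, ha⟩)
    rw [LinearMap.comp_apply, Finsupp.linearCombination_apply, Finsupp.sum,
      AddSubmonoidClass.coe_finsetSum] at h
    change _ = a at h
    refine (congrArg (· ∈ _) h).mp (Ideal.sum_mem _ fun i _ ↦ ?_)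
    change s ⟨a, ha⟩ i * (i : R) ∈ _
    rw [mul_comm (s ⟨a, ha⟩ i)]
    exact Ideal.mul_mem_mul i.2 (Ideal.subset_span ⟨i, rfl⟩)

theorem Ideal.exists_fractionalIdeal_mul_eq_one_iff {R : Type*} [CommRing R] {I : Ideal R} {a : R}
    (haI : a ∈ I) (ha : a ∈ R⁰) :
    (∃ J : FractionalIdeal R⁰ (FractionRing R),
      (I : FractionalIdeal R⁰ (FractionRing R)) * J = 1) ↔
      ∃ J : Ideal R, I * J = Ideal.span {a} := by
  constructor
  · rintro ⟨J, hJ⟩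
    have hle : ((Ideal.span {a} : Ideal R) : FractionalIdeal R⁰ (FractionRing R)) * J ≤ 1 := by
      rw [← hJ]
      gcongr
      exact (Ideal.span_singleton_le_iff_mem I).mpr haI
    obtain ⟨K, hK⟩ := FractionalIdeal.le_one_iff_exists_coeIdeal.mp hle
    refine ⟨K, (FractionalIdeal.coeIdeal_inj' (P := FractionRing R) le_rfl).mp ?_⟩
    rw [FractionalIdeal.coeIdeal_mul, hK, mul_left_comm, hJ, mul_one]
  · rintro ⟨J, hJ⟩
    refine ⟨(J : FractionalIdeal R⁰ (FractionRing R)) *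
      FractionalIdeal.spanSingleton R⁰ (IsLocalization.mk' (FractionRing R) 1 ⟨a, ha⟩), ?_⟩
    rw [← mul_assoc, ← FractionalIdeal.coeIdeal_mul, hJ, FractionalIdeal.coeIdeal_span_singleton,
      FractionalIdeal.spanSingleton_mul_spanSingleton,
      IsLocalization.mk'_spec' (FractionRing R) 1 ⟨a, ha⟩, map_one,
      FractionalIdeal.spanSingleton_one]

theorem Ideal.FG.exists_fg_map_eq_s10 {R S : Type*} [CommRing R] [CommRing S] {f : R →+* S}
    (hf : Function.Surjective f) {I : Ideal S} (hI : I.FG) :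
    ∃ J : Ideal R, J.FG ∧ J.map f = I := by
  classical
  obtain ⟨t, rfl⟩ := hI
  obtain ⟨u, rfl⟩ : ∃ u : Finset R, u.image f = t :=
    ⟨t.image (Function.surjInv hf), by
      rw [Finset.image_image, (Function.rightInverse_surjInv hf).comp_eq_id, Finset.image_id]⟩
  exact ⟨Ideal.span u, ⟨u, rfl⟩, by rw [Ideal.map_span, Finset.coe_image]⟩

theorem mul_eq_zero_of_projective_span_singleton {R : Type*} [CommRing R]
    (hprime : (nilradical R).IsPrime) {r s : R} [Module.Projective R (Ideal.span {r})]
    (hr : r ≠ 0) (hrs : r * s = 0) : s = 0 := by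
  let g : Ideal.span {r} := ⟨r, Ideal.mem_span_singleton_self r⟩
  obtain ⟨σ, hσ⟩ := LinearMap.exists_rightInverse_of_surjective
    (LinearMap.toSpanSingleton R _ g) <| by
    rw [LinearMap.range_eq_top]
    rintro ⟨x, hx⟩
    obtain ⟨c, rfl⟩ := Ideal.mem_span_singleton'.mp hx
    exact ⟨c, Subtype.ext rfl⟩
  have hg : σ g • g = g := DFunLike.congr_fun hσ g
  have hidem : σ g * σ g = σ g := by rw [← smul_eq_mul, ← map_smul, hg]
  have hs : s * σ g = 0 := by
    rw [← smul_eq_mul, ← map_smul, show s • g = 0 from Subtype.ext ((mul_comm s r).trans hrs),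
      map_zero]
  have hmem : σ g * (1 - σ g) ∈ nilradical R := by simp [mul_sub, hidem]
  have hidem' : IsIdempotentElem (σ g) := hidem
  rcases hprime.mem_or_mem hmem with h | h
  · have h0 := hidem'.eq_zero_of_isNilpotent h
    exact absurd (congrArg Subtype.val hg) (by simpa [h0, g] using hr.symm)
  · have h0 := hidem'.one_sub.eq_zero_of_isNilpotent h
    rw [← sub_eq_zero.mp h0, mul_one] at hs
    exact hs

/-- In a φ-ring, a non-nilpotent element divides every nilpotent one, with nilpotent quotient, so
factorizations of the principal ideal it generates lift from the reduced quotient. -/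
theorem IsPhiRing.mul_comap_eq_span_singleton {R : Type*} [CommRing R] (hR : IsPhiRing R)
    {I : Ideal R} {J : Ideal (R ⧸ nilradical R)} {a : R} (haI : a ∈ I) (ha : a ∉ nilradical R)
    (h : I.map (Ideal.Quotient.mk (nilradical R)) * J =
      Ideal.span {Ideal.Quotient.mk (nilradical R) a}) :
    I * J.comap (Ideal.Quotient.mk (nilradical R)) = Ideal.span {a} := by
  have hsurj : Function.Surjective (Ideal.Quotient.mk (nilradical R)) :=
    Ideal.Quotient.mk_surjective
  have hle : nilradical R ≤ Ideal.span {a} := (hR.2 _).resolve_left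
    fun hle ↦ ha (hle (Ideal.mem_span_singleton_self a))
  have hleJ : nilradical R ≤ J.comap (Ideal.Quotient.mk (nilradical R)) := by
    intro x hx
    rw [Ideal.mem_comap, Ideal.Quotient.eq_zero_iff_mem.mpr hx]
    exact J.zero_mem
  have hleI : nilradical R ≤ I * J.comap (Ideal.Quotient.mk (nilradical R)) := by
    intro x hx
    obtain ⟨c, rfl⟩ := Ideal.mem_span_singleton.mp (hle hx)
    exact Ideal.mul_mem_mul haI (hleJ ((hR.1.mem_or_mem hx).resolve_left ha))
  have key : (I * J.comap (Ideal.Quotient.mk (nilradical R))).map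
      (Ideal.Quotient.mk (nilradical R)) =
      (Ideal.span {a}).map (Ideal.Quotient.mk (nilradical R)) := by
    rw [Ideal.map_mul, Ideal.map_comap_of_surjective _ hsurj, h, Ideal.map_span,
      Set.image_singleton]
  have := congrArg (Ideal.comap (Ideal.Quotient.mk (nilradical R))) key
  rwa [Ideal.comap_map_of_surjective' _ hsurj, Ideal.comap_map_of_surjective' _ hsurj,
    Ideal.mk_ker, sup_eq_left.mpr hleI, sup_eq_left.mpr hle] at this

theorem phiPrufer_strong_iff_nonnil_semihereditary (R : Type*) [CommRing R]
    (hR : IsPhiRing R) :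
    (IsPhiPrufer R ∧ {r : R | ∃ s : R, s ≠ 0 ∧ r * s = 0} = {r : R | IsNilpotent r}) ↔
      ∀ I : Ideal R, ¬I ≤ nilradical R → I.FG → Module.Projective R I := by
  have hprime := hR.1
  have hquot {a : R} (ha : a ∉ nilradical R) :
      Ideal.Quotient.mk (nilradical R) a ∈ (R ⧸ nilradical R)⁰ :=
    mem_nonZeroDivisors_of_ne_zero fun h ↦ ha (Ideal.Quotient.eq_zero_iff_mem.mp h)
  constructor
  · rintro ⟨hP, hZ⟩ I hI hfg
    obtain ⟨a, haI, ha⟩ := SetLike.not_le_iff_exists.mp hI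
    have hreg : a ∈ R⁰ := by
      rw [mem_nonZeroDivisors_iff_left]
      intro s hs
      by_contra hs0
      exact ha (hZ.subset ⟨s, hs0, hs⟩)
    have hne : I.map (Ideal.Quotient.mk (nilradical R)) ≠ ⊥ := by
      rwa [Ne, Ideal.map_eq_bot_iff_le_ker, Ideal.mk_ker]
    obtain ⟨J, hJ⟩ := (Ideal.exists_fractionalIdeal_mul_eq_one_iff (Ideal.mem_map_of_mem _ haI)
      (hquot ha)).mp (hP _ hne (hfg.map _))
    exact Ideal.projective_of_mul_eq_span_singleton hreg
      (hR.mul_comap_eq_span_singleton haI ha hJ)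
  · intro H
    constructor
    · intro I hI hfg
      obtain ⟨K, hK, rfl⟩ := hfg.exists_fg_map_eq_s10
        (Ideal.Quotient.mk_surjective (I := nilradical R))
      rw [Ne, Ideal.map_eq_bot_iff_le_ker, Ideal.mk_ker] at hI
      obtain ⟨a, haK, ha⟩ := SetLike.not_le_iff_exists.mp hI
      have := H K hI hK
      obtain ⟨J, hJ⟩ := Ideal.exists_mul_eq_span_singleton_of_projective haK
      refine (Ideal.exists_fractionalIdeal_mul_eq_one_iff (Ideal.mem_map_of_mem
        (Ideal.Quotient.mk (nilradical R)) haK)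
        (hquot ha)).mpr ⟨J.map (Ideal.Quotient.mk (nilradical R)), ?_⟩
      rw [← Ideal.map_mul, hJ, Ideal.map_span, Set.image_singleton]
    · ext r
      constructor
      · rintro ⟨s, hs, hrs⟩
        by_contra hr
        have := H (Ideal.span {r})
          (fun hle ↦ hr (hle (Ideal.mem_span_singleton_self r))) ⟨{r}, by simp⟩
        exact hs (mul_eq_zero_of_projective_span_singleton hprime
          (by rintro rfl; exact hr IsNilpotent.zero) hrs)
      · intro hr
        have : Nontrivial R :=
          ⟨0, 1, fun h ↦ hprime.ne_top ((Ideal.eq_top_iff_one _).mpr (h ▸ Ideal.zero_mem _))⟩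
        by_contra hcon
        have hreg : r ∈ R⁰ := by
          rw [mem_nonZeroDivisors_iff_left]
          intro s hs
          by_contra hs0
          exact hcon ⟨s, hs0, hs⟩
        obtain ⟨n, hn⟩ := hr
        exact zero_notMem_nonZeroDivisors (hn ▸ pow_mem hreg n)
end

section
/- Let R be a φ-ring (a commutative ring whose nilradical Nil(R) is a divided prime ideal). Then R is a φ-Prüfer ring (equivalently, R/Nil(R) is a Prüfer domain) and Z(R) = Nil(R) (every zerodivisor of R is nilpotent) if and only if every nonnil ideal of R is flat as an R-module. -/
namespace Ideal

open Module nonZeroDivisors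

variable {R : Type*} [CommRing R]

theorem mem_colon_span_singleton_iff_dvd {I : Ideal R} {x c : R} :
    c ∈ (span {x}).colon (I : Set R) ↔ ∀ a ∈ I, x ∣ c * a := by
  simp [Submodule.mem_colon, mem_span_singleton]

theorem mul_colon_span_singleton_le (I : Ideal R) (x : R) :
    I * (span {x}).colon (I : Set R) ≤ span {x} :=
  mul_le.mpr fun a ha c hc ↦ mem_span_singleton.mpr <|
    mul_comm c a ▸ mem_colon_span_singleton_iff_dvd.mp hc a ha

theorem exists_fin_sum_mul_of_mem_mul {I J : Ideal R} {z : R} (hz : z ∈ I * J) :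
    ∃ (n : ℕ) (y c : Fin n → R), (∀ j, y j ∈ I) ∧ (∀ j, c j ∈ J) ∧ z = ∑ j, y j * c j := by
  rw [Submodule.mul_eq_span_mul_set, Submodule.mem_span_set'] at hz
  obtain ⟨n, f, g, rfl⟩ := hz
  choose y hy c hc h using fun j ↦ Set.mem_mul.mp (g j).2
  refine ⟨n, fun j ↦ f j * y j, c, fun j ↦ I.mul_mem_left _ (hy j), hc, ?_⟩
  simp only [← h, smul_eq_mul, mul_assoc]

/-- A finitely generated flat ideal `I` satisfies `x ∈ I * (x : I)` for every `x ∈ I`. -/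
theorem mem_mul_colon_of_flat {I : Ideal R} (hI : I.FG) [Flat R I] {x : R} (hx : x ∈ I) :
    x ∈ I * (span {x}).colon (I : Set R) := by
  have : Module.Finite R I := Module.Finite.of_fg hI
  obtain ⟨n, p, hp⟩ := Module.Finite.exists_fin' R I
  obtain ⟨ξ, hξ⟩ := hp ⟨x, hx⟩
  let f : (Fin n → R) →ₗ[R] (Fin n → R) :=
    x • LinearMap.id - (I.subtype ∘ₗ p).smulRight ξ
  have hf : p ∘ₗ f = 0 := by
    refine LinearMap.ext fun v ↦ Subtype.ext ?_
    simp [f, hξ, mul_comm]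
  obtain ⟨k, a, y, hpy, haf⟩ := Flat.exists_factorization_of_comp_eq_zero_of_free hf
  have ha (v : Fin n → R) : x • a v = (p v : R) • a ξ := by
    have := LinearMap.congr_fun haf v
    simpa [f, sub_eq_zero] using this
  have hsum : x = ∑ j, (y (Finsupp.single j 1) : R) * a ξ j := by
    have h : y (a ξ) = ⟨x, hx⟩ := by rw [← hξ, hpy]; rfl
    rw [← Finsupp.univ_sum_single (a ξ), map_sum] at h
    have h' := congrArg Subtype.val h
    rw [AddSubmonoidClass.coe_finsetSum] at h'
    refine h'.symm.trans (Finset.sum_congr rfl fun j _ ↦ ?_)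
    rw [← mul_one (a ξ j), ← smul_eq_mul (a ξ j), ← Finsupp.smul_single, map_smul]
    simp [mul_comm]
  suffices h : ∑ j, (y (Finsupp.single j 1) : R) * a ξ j ∈ I * (span {x}).colon (I : Set R) by
    rwa [← hsum] at h
  refine _root_.sum_mem fun j _ ↦ mul_mem_mul (y _).2 <|
    mem_colon_span_singleton_iff_dvd.mpr fun b hb ↦ ?_
  obtain ⟨v, hv⟩ := hp ⟨b, hb⟩
  refine ⟨a v j, ?_⟩
  have := DFunLike.congr_fun (ha v) j
  simpa [hv, mul_comm] using this.symm

/-- An ideal `I` is flat if every finite subset of `I` lies in an ideal `I₀ ≤ I` for which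
`x ∈ I₀ * (x : I₀)`, where `x` is a non-zero-divisor. -/
theorem flat_of_forall_mem_mul_colon {I : Ideal R}
    (h : ∀ s : Finset R, (s : Set R) ⊆ I → ∃ I₀ ≤ I, (s : Set R) ⊆ I₀ ∧
      ∃ x ∈ R⁰, x ∈ I₀ * (span {x}).colon (I₀ : Set R)) : Flat R I := by
  classical
  refine Flat.of_forall_isTrivialRelation fun {l f g} hfg ↦ ?_
  obtain ⟨I₀, hle, hs, x, hx, hmem⟩ :=
    h (Finset.univ.image fun i ↦ (g i : R)) (by simp [Set.range_subset_iff])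
  have hg (i) : (g i : R) ∈ I₀ := hs (by simp)
  obtain ⟨n, y, c, hy, hc, hsum⟩ := exists_fin_sum_mul_of_mem_mul hmem
  choose a ha using fun i j ↦ mem_colon_span_singleton_iff_dvd.mp (hc j) (g i) (hg i)
  refine ⟨n, a, fun j ↦ ⟨y j, hle (hy j)⟩, fun i ↦ Subtype.ext ?_, fun j ↦ ?_⟩
  · rw [AddSubmonoidClass.coe_finsetSum]
    refine (mul_cancel_left_mem_nonZeroDivisors hx).mp ?_
    conv_lhs => rw [hsum]
    rw [Finset.sum_mul, Finset.mul_sum]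
    refine Finset.sum_congr rfl fun j _ ↦ ?_
    simp only [SetLike.mk_smul_mk, smul_eq_mul, ← mul_assoc, ← ha]
    ring
  · refine (mul_left_mem_nonZeroDivisors_eq_zero_iff hx).mp ?_
    have hfg' := congrArg Subtype.val hfg
    rw [AddSubmonoidClass.coe_finsetSum] at hfg'
    simp only [SetLike.val_smul, smul_eq_mul, ZeroMemClass.coe_zero] at hfg'
    rw [Finset.mul_sum, ← mul_zero (c j), ← hfg', Finset.mul_sum]
    exact Finset.sum_congr rfl fun i _ ↦ by rw [mul_left_comm, ← ha, mul_left_comm]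

/-- In a domain, an ideal is invertible if and only if `x ∈ I * (x : I)`, where `x` is any nonzero
element of `I`. -/
theorem exists_fractionalIdeal_mul_eq_one_iff_s11 {D : Type*} [CommRing D] [IsDomain D] (K : Type*)
    [Field K] [Algebra D K] [IsFractionRing D K] {I : Ideal D} {x : D} (hx : x ∈ I)
    (hx0 : x ≠ 0) :
    (∃ J : FractionalIdeal D⁰ K, (I : FractionalIdeal D⁰ K) * J = 1) ↔
      x ∈ I * (span {x}).colon (I : Set D) := by
  have hinj := IsFractionRing.injective D K
  have hxK : algebraMap D K x ≠ 0 := by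
    simpa using hinj.ne hx0
  constructor
  · rintro ⟨J, hJ⟩
    have key : ∀ z ∈ (I : FractionalIdeal D⁰ K) * J,
        ∃ d ∈ I * (span {x}).colon (I : Set D), algebraMap D K d = algebraMap D K x * z := by
      intro z hz
      refine FractionalIdeal.mul_induction_on hz ?_ ?_
      · intro i hi t ht
        have hmul : ∀ a ∈ I, ∃ d, algebraMap D K d = algebraMap D K a * t := fun a ha ↦ by
          have : algebraMap D K a * t ∈ (I : FractionalIdeal D⁰ K) * J :=
            FractionalIdeal.mul_mem_mul (FractionalIdeal.mem_coeIdeal_of_mem _ ha) ht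
          rw [hJ] at this
          exact (FractionalIdeal.mem_one_iff _).mp this
        obtain ⟨i, hiI, rfl⟩ := (FractionalIdeal.mem_coeIdeal _).mp hi
        obtain ⟨c, hc⟩ := hmul x hx
        refine ⟨i * c, mul_mem_mul hiI <| mem_colon_span_singleton_iff_dvd.mpr fun a ha ↦ ?_, ?_⟩
        · obtain ⟨d, hd⟩ := hmul a ha
          refine ⟨d, hinj ?_⟩
          rw [map_mul, map_mul, hc, hd]
          ring
        · rw [map_mul, hc]
          ring
      · rintro _ _ ⟨d, hd, hd'⟩ ⟨e, he, he'⟩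
        exact ⟨d + e, add_mem hd he, by rw [map_add, hd', he', mul_add]⟩
    obtain ⟨d, hd, hd'⟩ := key 1 (hJ ▸ FractionalIdeal.one_mem_one _)
    rw [mul_one] at hd'
    exact hinj hd' ▸ hd
  · intro h
    have heq : I * (span {x}).colon (I : Set D) = span {x} :=
      le_antisymm (mul_colon_span_singleton_le I x) ((span_singleton_le_iff_mem _).mpr h)
    refine ⟨((span {x}).colon (I : Set D) : Ideal D) *
      FractionalIdeal.spanSingleton D⁰ (algebraMap D K x)⁻¹, ?_⟩
    rw [← mul_assoc, ← FractionalIdeal.coeIdeal_mul, heq, FractionalIdeal.coeIdeal_span_singleton,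
      FractionalIdeal.spanSingleton_mul_spanSingleton, mul_inv_cancel₀ hxK,
      FractionalIdeal.spanSingleton_one]

theorem map_mk_mem_mul_colon {N I : Ideal R} {x : R}
    (h : x ∈ I * (span {x}).colon (I : Set R)) :
    Quotient.mk N x ∈ I.map (Quotient.mk N) *
      (span {Quotient.mk N x}).colon (I.map (Quotient.mk N) : Set (R ⧸ N)) := by
  have := mem_map_of_mem (Quotient.mk N) h
  rw [Ideal.map_mul] at this
  refine mul_mono_right (map_le_iff_le_comap.mpr fun c hc ↦ ?_) this
  refine mem_colon_span_singleton_iff_dvd.mpr fun b hb ↦ ?_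
  obtain ⟨a, ha, rfl⟩ := (mem_map_iff_of_surjective _ Quotient.mk_surjective).mp hb
  rw [← map_mul]
  exact map_dvd _ (mem_colon_span_singleton_iff_dvd.mp hc a ha)

/-- If `N` is a nil ideal with `N = x N`, then the relation `x ∈ I * (x : I)` lifts
along `R → R ⧸ N`. -/
theorem mem_mul_colon_of_map_mk {N I : Ideal R} {x : R} (hN : N ≤ nilradical R)
    (hx : ∀ n ∈ N, ∃ m ∈ N, n = x * m)
    (h : Quotient.mk N x ∈ I.map (Quotient.mk N) *
      (span {Quotient.mk N x}).colon (I.map (Quotient.mk N) : Set (R ⧸ N))) :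
    x ∈ I * (span {x}).colon (I : Set R) := by
  have hcolon : (span {Quotient.mk N x}).colon (I.map (Quotient.mk N) : Set (R ⧸ N)) ≤
      ((span {x}).colon (I : Set R)).map (Quotient.mk N) := by
    intro c hc
    obtain ⟨c, rfl⟩ := Quotient.mk_surjective c
    refine mem_map_of_mem _ <| mem_colon_span_singleton_iff_dvd.mpr fun a ha ↦ ?_
    obtain ⟨d, hd⟩ := mem_colon_span_singleton_iff_dvd.mp hc _ (mem_map_of_mem _ ha)
    obtain ⟨d, rfl⟩ := Quotient.mk_surjective d
    rw [← map_mul, ← map_mul, Quotient.eq] at hd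
    obtain ⟨m, -, hm⟩ := hx _ hd
    exact ⟨d + m, by linear_combination hm⟩
  have h' := mul_mono_right hcolon h
  rw [← Ideal.map_mul, mem_map_iff_of_surjective _ Quotient.mk_surjective] at h'
  obtain ⟨z, hz, hzx⟩ := h'
  obtain ⟨m, hm, hzm⟩ := hx _ (Quotient.eq.mp hzx)
  have hu : IsUnit (1 + m) := IsNilpotent.isUnit_one_add (hN hm)
  obtain rfl : z = x * (1 + m) := by linear_combination hzm
  exact (unit_mul_mem_iff_mem _ hu).mp (mul_comm x _ ▸ hz)

/-- If `r` generates a flat ideal, then its annihilator is a pure ideal. -/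
theorem exists_mul_eq_self_of_flat_span_singleton {r s : R} [Flat R (span {r})]
    (h : s * r = 0) : ∃ b, b * r = r ∧ s * b = 0 := by
  let g : span {r} := ⟨r, mem_span_singleton_self r⟩
  obtain ⟨k, a, y, hg, ha⟩ := Flat.isTrivialRelation_of_sum_smul_eq_zero
    (ι := Unit) (f := fun _ ↦ s) (x := fun _ ↦ g) (by simpa [g] using h)
  choose c hc using fun j ↦ mem_span_singleton'.mp (y j).2
  refine ⟨∑ j, a () j * c j, ?_, ?_⟩
  · have := congrArg Subtype.val (hg ())
    rw [AddSubmonoidClass.coe_finsetSum] at this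
    simp only [SetLike.val_smul, smul_eq_mul, ← hc] at this
    simpa [Finset.sum_mul, mul_assoc] using this.symm
  · rw [Finset.mul_sum]
    exact Finset.sum_eq_zero fun j _ ↦ by
      rw [← mul_assoc, show s * a () j = 0 by simpa using ha j, zero_mul]

end Ideal

namespace IsPhiRing

variable {R : Type*} [CommRing R]

theorem exists_eq_mul_of_mem_nilradical (hR : IsPhiRing R) {x : R} (hx : x ∉ nilradical R)
    {n : R} (hn : n ∈ nilradical R) : ∃ m ∈ nilradical R, n = x * m := by
  have hle : nilradical R ≤ Ideal.span {x} :=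
    (hR.2 _).resolve_left fun h ↦ hx (h (Ideal.mem_span_singleton_self x))
  obtain ⟨m, rfl⟩ := Ideal.mem_span_singleton.mp (hle hn)
  exact ⟨m, (hR.1.mem_or_mem hn).resolve_left hx, rfl⟩

theorem isPhiPrufer_of_flat (hR : IsPhiRing R)
    (h : ∀ I : Ideal R, ¬I ≤ nilradical R → Module.Flat R I) : IsPhiPrufer R := by
  have := hR.1
  intro I hI ⟨s, hs⟩
  classical
  obtain ⟨t, rfl⟩ : ∃ t : Finset R, t.image (Ideal.Quotient.mk (nilradical R)) = s :=
    ⟨s.image Quotient.out, by simp [Finset.image_image, Function.comp_def]⟩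
  have hmap : (Ideal.span (t : Set R)).map (Ideal.Quotient.mk (nilradical R)) = I := by
    rw [Ideal.map_span, ← hs, Finset.coe_image]
  subst hmap
  have hnon : ¬Ideal.span (t : Set R) ≤ nilradical R := by
    rwa [Ne, Ideal.map_eq_bot_iff_le_ker, Ideal.mk_ker] at hI
  have := h _ hnon
  obtain ⟨x, hx, hx0⟩ := Set.not_subset.mp hnon
  exact (Ideal.exists_fractionalIdeal_mul_eq_one_iff_s11 _ (Ideal.mem_map_of_mem _ hx)
    (by rwa [Ne, Ideal.Quotient.eq_zero_iff_mem])).mpr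
    (Ideal.map_mk_mem_mul_colon (Ideal.mem_mul_colon_of_flat ⟨t, rfl⟩ hx))

theorem isNilpotent_of_mul_eq_zero_of_flat (hR : IsPhiRing R)
    (h : ∀ I : Ideal R, ¬I ≤ nilradical R → Module.Flat R I) {r s : R} (hs : s ≠ 0)
    (hrs : r * s = 0) : IsNilpotent r := by
  by_contra hr
  have := h (Ideal.span {r}) fun hle ↦ hr (hle (Ideal.mem_span_singleton_self r))
  obtain ⟨b, hb, hsb⟩ :=
    Ideal.exists_mul_eq_self_of_flat_span_singleton ((mul_comm s r).trans hrs)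
  have hmem : (1 - b) * r ∈ nilradical R := by
    rw [sub_mul, hb, one_mul, sub_self]
    exact zero_mem _
  have hnil : IsNilpotent (1 - b) := (hR.1.mem_or_mem hmem).resolve_right hr
  have hu : IsUnit b := by simpa using hnil.isUnit_one_sub
  exact hs (hu.mul_left_eq_zero.mp hsb)

theorem flat_of_isPhiPrufer (hR : IsPhiRing R) (hP : IsPhiPrufer R)
    (hZ : ∀ r s : R, s ≠ 0 → r * s = 0 → IsNilpotent r) {I : Ideal R}
    (hI : ¬I ≤ nilradical R) : Module.Flat R I := by
  classical
  have := hR.1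
  obtain ⟨x, hx, hx0⟩ := Set.not_subset.mp hI
  refine Ideal.flat_of_forall_mem_mul_colon fun s hs ↦
    ⟨Ideal.span (insert x s : Finset R), ?_, ?_, x, ?_, ?_⟩
  · rw [Ideal.span_le, Finset.coe_insert]
    exact Set.insert_subset hx hs
  · exact (Finset.coe_subset.mpr (Finset.subset_insert x s)).trans Ideal.subset_span
  · refine mem_nonZeroDivisors_iff_left.mpr fun y hy ↦ ?_
    by_contra hy0
    exact hx0 (hZ x y hy0 hy)
  · have hxs : x ∈ Ideal.span (insert x s : Finset R) := Ideal.subset_span (by simp)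
    have hxs' := Ideal.mem_map_of_mem (Ideal.Quotient.mk (nilradical R)) hxs
    have hx' : Ideal.Quotient.mk (nilradical R) x ≠ 0 := by
      rwa [Ne, Ideal.Quotient.eq_zero_iff_mem]
    refine Ideal.mem_mul_colon_of_map_mk le_rfl
      (fun n hn ↦ hR.exists_eq_mul_of_mem_nilradical hx0 hn) ?_
    refine (Ideal.exists_fractionalIdeal_mul_eq_one_iff_s11 _ hxs' hx').mp (hP _ ?_ ?_)
    · exact fun h ↦ hx' (Ideal.mem_bot.mp (h ▸ hxs'))
    · exact Ideal.FG.map ⟨_, rfl⟩ _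

end IsPhiRing

theorem phiPrufer_strong_iff_nonnil_ideals_flat (R : Type*) [CommRing R]
    (hR : IsPhiRing R) :
    (IsPhiPrufer R ∧ {r : R | ∃ s : R, s ≠ 0 ∧ r * s = 0} = {r : R | IsNilpotent r}) ↔
      ∀ I : Ideal R, ¬I ≤ nilradical R → Module.Flat R I := by
  constructor
  · rintro ⟨hP, hZ⟩ I hI
    exact hR.flat_of_isPhiPrufer hP (fun r s hs hrs ↦ hZ.subset ⟨s, hs, hrs⟩) hI
  · intro h
    refine ⟨hR.isPhiPrufer_of_flat h, Set.Subset.antisymm ?_ fun r hr ↦ ?_⟩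
    · rintro r ⟨s, hs, hrs⟩
      exact hR.isNilpotent_of_mul_eq_zero_of_flat h hs hrs
    · by_contra! hreg
      have : Nontrivial R := ⟨0, 1, fun h01 ↦
        (Ideal.ne_top_iff_one _).mp hR.1.ne_top (h01 ▸ zero_mem _)⟩
      have hr' : r ∈ nonZeroDivisors R := mem_nonZeroDivisors_iff_left.mpr fun y hy ↦ by
        by_contra hy0
        exact hreg ⟨y, hy0, hy⟩
      exact nonZeroDivisors.ne_zero (pow_mem hr' _) hr.choose_spec
end

section
/- Let R be a semi-local φ-ring (a commutative ring with only finitely many maximal ideals whose nilradical Nil(R) is a divided prime ideal). If R is a φ-Prüfer ring (equivalently, R/Nil(R) is a Prüfer domain), then R is a φ-Bézout ring, i.e., R/Nil(R) is a Bézout domain: every finitely generated ideal of R/Nil(R) is principal. -/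
/-- Finiteness of the set of maximal ideals passes to quotients. -/
theorem finite_setOf_isMaximal_quotient {R : Type*} [CommRing R] (I : Ideal R)
    (h : {M : Ideal R | M.IsMaximal}.Finite) : {M : Ideal (R ⧸ I) | M.IsMaximal}.Finite := by
  refine Set.Finite.of_finite_image (f := Ideal.comap (Ideal.Quotient.mk I)) (h.subset ?_)
    (Ideal.comap_injective_of_surjective _ Ideal.Quotient.mk_surjective).injOn
  rintro _ ⟨M, hM, rfl⟩
  have : M.IsMaximal := hM
  exact Ideal.comap_isMaximal_of_surjective _ Ideal.Quotient.mk_surjective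

theorem phiBezout_of_semilocal_phiPrufer (R : Type*) [CommRing R]
    (hR : IsPhiRing R) (hsl : {M : Ideal R | M.IsMaximal}.Finite)
    (hP : IsPhiPrufer R) :
    ∀ I : Ideal (R ⧸ nilradical R), I.FG → I.IsPrincipal := by
  intro I hI
  by_cases h0 : I = ⊥
  · subst h0
    exact bot_isPrincipal
  obtain ⟨J, hJ⟩ := hP I h0 hI
  have hprin := FractionalIdeal.isPrincipal.of_finite_maximals_of_inv le_rfl
    (finite_setOf_isMaximal_quotient _ hsl) _ J hJ
  rw [FractionalIdeal.coe_coeIdeal] at hprin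
  exact (IsLocalization.coeSubmodule_isPrincipal _ le_rfl).mp hprin
end

section
/- Let R be a φ-ring (a commutative ring whose nilradical Nil(R) is a divided prime ideal). If R is a φ-Prüfer ring (equivalently, R/Nil(R) is a Prüfer domain), then every primary nonnil ideal q of R is irreducible, i.e., whenever q = I ∩ J for ideals I, J of R, one has q = I or q = J. -/
/-- If a two-generated ideal `(x, y)` of a domain is invertible, then it is locally principal:
there is `s` such that `x ∣ s * y` and `y ∣ (1 - s) * x`. -/
lemma exists_dvd_mul_dvd_one_sub_mul_of_invertible {D : Type*} [CommRing D] [IsDomain D] (x y : D)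
    (J : FractionalIdeal (nonZeroDivisors D) (FractionRing D))
    (hJ : ((Ideal.span {x, y} : Ideal D) :
      FractionalIdeal (nonZeroDivisors D) (FractionRing D)) * J = 1) :
    ∃ s : D, x ∣ s * y ∧ y ∣ (1 - s) * x := by
  have integral : ∀ z ∈ (Ideal.span {x, y} : Ideal D), ∀ u ∈ J,
      ∃ d : D, algebraMap D (FractionRing D) d = algebraMap D (FractionRing D) z * u := by
    intro z hz u hu
    rw [← FractionalIdeal.mem_one_iff (nonZeroDivisors D), ← hJ]
    exact FractionalIdeal.mul_mem_mul (FractionalIdeal.mem_coeIdeal_of_mem _ hz) hu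
  have hx : x ∈ (Ideal.span {x, y} : Ideal D) := Ideal.subset_span (by simp)
  have hy : y ∈ (Ideal.span {x, y} : Ideal D) := Ideal.subset_span (by simp)
  have one_mem : (1 : FractionRing D) ∈ (1 : FractionalIdeal (nonZeroDivisors D) _) :=
    FractionalIdeal.one_mem_one _
  rw [← hJ, Ideal.span_insert, FractionalIdeal.coeIdeal_sup, add_mul,
    FractionalIdeal.coeIdeal_span_singleton, FractionalIdeal.coeIdeal_span_singleton,
    FractionalIdeal.mem_add] at one_mem
  obtain ⟨a, ha, b, hb, hab⟩ := one_mem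
  obtain ⟨u, hu, rfl⟩ := FractionalIdeal.mem_singleton_mul.mp ha
  obtain ⟨v, hv, rfl⟩ := FractionalIdeal.mem_singleton_mul.mp hb
  obtain ⟨s, hs⟩ := integral x hx u hu
  obtain ⟨c, hc⟩ := integral y hy u hu
  obtain ⟨d, hd⟩ := integral x hx v hv
  refine ⟨s, ⟨c, ?_⟩, ⟨d, ?_⟩⟩ <;> apply IsFractionRing.injective D (FractionRing D)
  · rw [map_mul, map_mul, hs, hc]; ring
  · rw [map_mul, map_mul, map_sub, map_one, hs, hd, ← hab]; ring

theorem primary_nonnil_irreducible_of_phiPrufer (R : Type*) [CommRing R]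
    (hR : IsPhiRing R) (hP : IsPhiPrufer R) :
    ∀ q : Ideal R, q.IsPrimary → ¬q ≤ nilradical R →
      ∀ I J : Ideal R, q = I ⊓ J → q = I ∨ q = J := by
  intro q hq hqn I J hIJ
  obtain ⟨hprime, hdivided⟩ := hR
  have hnil : nilradical R ≤ q := (hdivided q).resolve_left hqn
  have hqI : q ≤ I := hIJ ▸ inf_le_left
  have hqJ : q ≤ J := hIJ ▸ inf_le_right
  by_contra! hne
  obtain ⟨x, hxI, hxq⟩ := SetLike.exists_of_lt (lt_of_le_of_ne hqI hne.1)
  obtain ⟨y, hyJ, hyq⟩ := SetLike.exists_of_lt (lt_of_le_of_ne hqJ hne.2)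
  let π := Ideal.Quotient.mk (nilradical R)
  have hspan : (Ideal.span {π x, π y} : Ideal (R ⧸ nilradical R)) ≠ ⊥ := by
    intro h
    have hx : π x = 0 := Ideal.span_eq_bot.mp h _ (by simp)
    exact hxq (hnil (Ideal.Quotient.eq_zero_iff_mem.mp hx))
  obtain ⟨K, hK⟩ := hP _ hspan (Submodule.fg_span (by simp))
  obtain ⟨s, ⟨c, hc⟩, ⟨d, hd⟩⟩ := exists_dvd_mul_dvd_one_sub_mul_of_invertible _ _ K hK
  obtain ⟨s, rfl⟩ := Ideal.Quotient.mk_surjective s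
  obtain ⟨c, rfl⟩ := Ideal.Quotient.mk_surjective c
  obtain ⟨d, rfl⟩ := Ideal.Quotient.mk_surjective d
  have hc' : s * y - x * c ∈ q := hnil (Ideal.Quotient.eq.mp (by simpa using hc))
  have hd' : (1 - s) * x - y * d ∈ q := hnil (Ideal.Quotient.eq.mp (by simpa using hd))
  have hsy : y * s ∈ q := by
    rw [hIJ]
    refine ⟨?_, J.mul_mem_right _ hyJ⟩
    simpa [mul_comm] using I.add_mem (hqI hc') (I.mul_mem_right c hxI)
  have hsx : x * (1 - s) ∈ q := by
    rw [hIJ]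
    refine ⟨I.mul_mem_right _ hxI, ?_⟩
    simpa [mul_comm] using J.add_mem (hqJ hd') (J.mul_mem_right d hyJ)
  have hs := ((Ideal.isPrimary_iff.mp hq).2 hsy).resolve_left hyq
  have hs' := ((Ideal.isPrimary_iff.mp hq).2 hsx).resolve_left hxq
  have htop : q.radical = ⊤ := (Ideal.eq_top_iff_one _).mpr (by simpa using add_mem hs hs')
  exact (Ideal.isPrimary_iff.mp hq).1 (Ideal.radical_eq_top.mp htop)
end

section
/- Let R be a φ-ring (a commutative ring whose nilradical Nil(R) is a divided prime ideal) in which every nonnil prime ideal is maximal. If every primary nonnil ideal of R is irreducible (i.e., whenever such an ideal equals I ∩ J for ideals I, J, it equals I or J), then R is a φ-Prüfer ring, i.e., R/Nil(R) is a Prüfer domain. -/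
/-- The contraction to `D` of the extension of the principal ideal `(x)` to the localization
at the prime ideal `M`. -/
def Ideal.localizedSpan {D : Type*} [CommRing D] (M : Ideal D) [M.IsPrime] (x : D) : Ideal D where
  carrier := {r | ∃ t ∉ M, x ∣ t * r}
  zero_mem' := ⟨1, M.primeCompl.one_mem, by simp⟩
  add_mem' := by
    rintro a b ⟨t, ht, hta⟩ ⟨s, hs, hsb⟩
    refine ⟨t * s, M.primeCompl.mul_mem ht hs, ?_⟩
    have h : t * s * (a + b) = s * (t * a) + t * (s * b) := by ring
    exact h ▸ dvd_add (hta.mul_left s) (hsb.mul_left t)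
  smul_mem' := by
    rintro c a ⟨t, ht, hta⟩
    refine ⟨t, ht, ?_⟩
    have h : t * (c • a) = c * (t * a) := by simp only [smul_eq_mul]; ring
    exact h ▸ hta.mul_left c

theorem Ideal.mem_localizedSpan {D : Type*} [CommRing D] {M : Ideal D} [M.IsPrime] {x r : D} :
    r ∈ M.localizedSpan x ↔ ∃ t ∉ M, x ∣ t * r :=
  Iff.rfl

theorem Ideal.mem_localizedSpan_of_mul_mem {D : Type*} [CommRing D] {M : Ideal D} [M.IsPrime]
    {x r s : D} (hs : s ∉ M) (h : s * r ∈ M.localizedSpan x) : r ∈ M.localizedSpan x := by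
  obtain ⟨t, ht, hd⟩ := h
  exact ⟨t * s, M.primeCompl.mul_mem ht hs, by rwa [mul_assoc]⟩

/-- A nonzero proper ideal that is saturated with respect to the complement of a maximal ideal `M`
is primary if every nonzero prime ideal is maximal. -/
theorem Ideal.isPrimary_of_saturated {D : Type*} [CommRing D]
    (hmax : ∀ P : Ideal D, P.IsPrime → P ≠ ⊥ → P.IsMaximal)
    (M : Ideal D) [hM : M.IsMaximal] {q : Ideal D} (hq : q ≠ ⊥) (hqM : q ≠ ⊤)
    (hsat : ∀ s r : D, s ∉ M → s * r ∈ q → r ∈ q) : q.IsPrimary := by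
  refine Ideal.isPrimary_iff.2 ⟨hqM, fun {r s} hrs => ?_⟩
  by_cases hs : s ∈ M
  · right
    by_contra hrad
    have hdisj : Disjoint (q : Set D)
        ((M.primeCompl ⊔ Submonoid.powers s : Submonoid D) : Set D) := by
      rw [Set.disjoint_left]
      intro z hz hz'
      obtain ⟨t, ht, _, ⟨n, rfl⟩, rfl⟩ := Submonoid.mem_sup.1 hz'
      exact hrad ⟨n, hsat t _ ht hz⟩
    obtain ⟨P, hP, hqP, hPd⟩ := Ideal.exists_le_prime_disjoint q _ hdisj
    have hPmax := hmax P hP fun h => hq (le_bot_iff.1 (h ▸ hqP))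
    have hPM : P ≤ M := fun z hz => by
      by_contra hzM
      exact Set.disjoint_left.1 hPd hz
        ((le_sup_left : M.primeCompl ≤ M.primeCompl ⊔ Submonoid.powers s) hzM)
    have hsP : s ∈ P := hPmax.eq_of_le hM.ne_top hPM ▸ hs
    exact Set.disjoint_left.1 hPd hsP
      ((le_sup_right : Submonoid.powers s ≤ M.primeCompl ⊔ Submonoid.powers s)
        (Submonoid.mem_powers s))
  · exact Or.inl (hsat s r hs (mul_comm r s ▸ hrs))

/-- In a domain whose nonzero primes are maximal and whose nonzero primary ideals are irreducible,
divisibility is total locally at each maximal ideal. -/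
theorem exists_notMem_dvd_mul_or_dvd_mul {D : Type*} [CommRing D] [IsDomain D]
    (hmax : ∀ P : Ideal D, P.IsPrime → P ≠ ⊥ → P.IsMaximal)
    (hirr : ∀ q : Ideal D, q.IsPrimary → q ≠ ⊥ → ∀ I J : Ideal D, q = I ⊓ J → q = I ∨ q = J)
    (M : Ideal D) [M.IsMaximal] (x y : D) :
    ∃ t ∉ M, y ∣ t * x ∨ x ∣ t * y := by
  by_cases hxM : x ∈ M
  swap
  · exact ⟨x, hxM, Or.inr (dvd_mul_right x y)⟩
  by_cases hx : x = 0
  · exact ⟨1, M.primeCompl.one_mem, Or.inl (by simp [hx])⟩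
  by_cases hy : y = 0
  · exact ⟨1, M.primeCompl.one_mem, Or.inr (by simp [hy])⟩
  have hself : ∀ z, z ∈ M.localizedSpan z := fun z => ⟨1, M.primeCompl.one_mem, by simp⟩
  have hne : M.localizedSpan x ⊓ M.localizedSpan y ≠ ⊥ := fun h => mul_ne_zero hx hy <| by
    rw [← Ideal.mem_bot, ← h]
    exact ⟨Ideal.mul_mem_right _ _ (hself x), Ideal.mul_mem_left _ _ (hself y)⟩
  have htop : M.localizedSpan x ⊓ M.localizedSpan y ≠ ⊤ := fun h => by
    obtain ⟨t, ht, hd⟩ := ((Ideal.eq_top_iff_one _).1 h).1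
    exact ht (M.mem_of_dvd (by simpa using hd) hxM)
  have hprim := Ideal.isPrimary_of_saturated hmax M hne htop fun s r hs h =>
    ⟨Ideal.mem_localizedSpan_of_mul_mem hs h.1, Ideal.mem_localizedSpan_of_mul_mem hs h.2⟩
  rcases hirr _ hprim hne _ _ rfl with h | h
  · obtain ⟨t, ht, hd⟩ := (h.ge (hself x)).2
    exact ⟨t, ht, Or.inl hd⟩
  · obtain ⟨t, ht, hd⟩ := (h.ge (hself y)).1
    exact ⟨t, ht, Or.inr hd⟩

/-- If divisibility is total locally at `M`, finitely generated ideals are principal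
locally at `M`. -/
theorem Ideal.FG.exists_notMem_forall_dvd_mul {D : Type*} [CommRing D] (M : Ideal D) [M.IsPrime]
    (htot : ∀ x y : D, ∃ t ∉ M, y ∣ t * x ∨ x ∣ t * y) {I : Ideal D} (hI : I.FG) :
    ∃ a ∈ I, ∃ t ∉ M, ∀ z ∈ I, a ∣ t * z := by
  induction I, hI using Submodule.fg_induction with
  | singleton x =>
    exact ⟨x, Submodule.mem_span_singleton_self x, 1, M.primeCompl.one_mem, fun z hz => by
      simpa using Ideal.mem_span_singleton.1 hz⟩
  | sup I J _ _ hI hJ =>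
    obtain ⟨a, ha, t, ht, hat⟩ := hI
    obtain ⟨b, hb, s, hs, hbs⟩ := hJ
    obtain ⟨u, hu, h⟩ := htot a b
    have hmem := M.primeCompl.mul_mem (M.primeCompl.mul_mem hu ht) hs
    rcases h with h | h
    · refine ⟨b, Submodule.mem_sup_right hb, u * t * s, hmem, fun z hz => ?_⟩
      obtain ⟨v, hv, w, hw, rfl⟩ := Submodule.mem_sup.1 hz
      have e : u * t * s * (v + w) = s * (u * (t * v)) + u * t * (s * w) := by ring
      exact e ▸ dvd_add ((h.trans (mul_dvd_mul_left u (hat v hv))).mul_left s)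
        ((hbs w hw).mul_left _)
    · refine ⟨a, Submodule.mem_sup_left ha, u * t * s, hmem, fun z hz => ?_⟩
      obtain ⟨v, hv, w, hw, rfl⟩ := Submodule.mem_sup.1 hz
      have e : u * t * s * (v + w) = u * s * (t * v) + t * (u * (s * w)) := by ring
      exact e ▸ dvd_add ((hat v hv).mul_left _)
        ((h.trans (mul_dvd_mul_left u (hbs w hw))).mul_left t)

/-- A nonzero ideal of a domain that is locally principal, with denominators cleared uniformly, is
invertible. -/
theorem FractionalIdeal.coeIdeal_mul_inv_of_forall_isMaximal {D : Type*} [CommRing D] [IsDomain D]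
    (K : Type*) [Field K] [Algebra D K] [IsFractionRing D K] {I : Ideal D} (hI : I ≠ ⊥)
    (hloc : ∀ M : Ideal D, M.IsMaximal → ∃ a ∈ I, ∃ t ∉ M, ∀ z ∈ I, a ∣ t * z) :
    (I : FractionalIdeal (nonZeroDivisors D) K) * (I : FractionalIdeal (nonZeroDivisors D) K)⁻¹
      = 1 := by
  have hI' : (I : FractionalIdeal (nonZeroDivisors D) K) ≠ 0 := coeIdeal_ne_zero.2 hI
  obtain ⟨Q, hQ⟩ := le_one_iff_exists_coeIdeal.1
    (mul_one_div_le_one (I := (I : FractionalIdeal (nonZeroDivisors D) K)))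
  rw [← inv_eq] at hQ
  rw [← hQ, ← coeIdeal_top]
  congr 1
  by_contra hne
  obtain ⟨M, hM, hQM⟩ := Ideal.exists_le_maximal Q hne
  obtain ⟨a, ha, t, ht, hd⟩ := hloc M hM
  have ha0 : a ≠ 0 := by
    rintro rfl
    obtain ⟨z, hz, hz0⟩ := Submodule.exists_mem_ne_zero_of_ne_bot hI
    rcases mul_eq_zero.1 (zero_dvd_iff.1 (hd z hz)) with h | h
    · exact ht (h ▸ M.zero_mem)
    · exact hz0 h
  have haK : algebraMap D K a ≠ 0 := by simpa using ha0
  have hinv : algebraMap D K t / algebraMap D K a ∈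
      (I : FractionalIdeal (nonZeroDivisors D) K)⁻¹ := by
    rw [mem_inv_iff hI']
    rintro _ hy
    obtain ⟨z, hz, rfl⟩ := (mem_coeIdeal _).1 hy
    obtain ⟨c, hc⟩ := hd z hz
    refine (mem_one_iff _).2 ⟨c, ?_⟩
    rw [div_mul_eq_mul_div, eq_div_iff haK, ← map_mul, ← map_mul, hc, mul_comm]
  have htQ := mul_mem_mul ((mem_coeIdeal (nonZeroDivisors D)).2 ⟨a, ha, rfl⟩) hinv
  rw [mul_div_cancel₀ _ haK, ← hQ] at htQ
  obtain ⟨t', ht', h⟩ := (mem_coeIdeal _).1 htQ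
  exact ht (IsFractionRing.injective D K h ▸ hQM ht')

theorem phiPrufer_of_primary_nonnil_irreducible (R : Type*) [CommRing R]
    (hR : IsPhiRing R)
    (hmax : ∀ P : Ideal R, P.IsPrime → ¬P ≤ nilradical R → P.IsMaximal)
    (hirr : ∀ q : Ideal R, q.IsPrimary → ¬q ≤ nilradical R →
      ∀ I J : Ideal R, q = I ⊓ J → q = I ∨ q = J) :
    IsPhiPrufer R := by
  have hprime : (nilradical R).IsPrime := hR.1
  have hsurj : Function.Surjective (Ideal.Quotient.mk (nilradical R)) :=
    Ideal.Quotient.mk_surjective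
  have hinj := Ideal.comap_injective_of_surjective _ hsurj
  have hnonnil : ∀ q : Ideal (R ⧸ nilradical R), q ≠ ⊥ →
      ¬ q.comap (Ideal.Quotient.mk (nilradical R)) ≤ nilradical R := fun q hq h => hq <| by
    rw [← Ideal.map_comap_of_surjective _ hsurj q, Ideal.map_eq_bot_iff_le_ker, Ideal.mk_ker]
    exact h
  have hmax' : ∀ P : Ideal (R ⧸ nilradical R), P.IsPrime → P ≠ ⊥ → P.IsMaximal := by
    intro P hP hne
    have h := Ideal.map_eq_top_or_isMaximal_of_surjective _ hsurj
      (hmax _ (hP.comap _) (hnonnil P hne))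
    rw [Ideal.map_comap_of_surjective _ hsurj] at h
    exact h.resolve_left hP.ne_top
  have hirr' : ∀ q : Ideal (R ⧸ nilradical R), q.IsPrimary → q ≠ ⊥ →
      ∀ I J : Ideal (R ⧸ nilradical R), q = I ⊓ J → q = I ∨ q = J := fun q hq hne I J h =>
    (hirr _ (hq.comap _) (hnonnil q hne) (I.comap _) (J.comap _)
      (by rw [h, Ideal.comap_inf])).imp (@hinj _ _) (@hinj _ _)
  intro I hI hfg
  exact ⟨_, FractionalIdeal.coeIdeal_mul_inv_of_forall_isMaximal _ hI fun M hM =>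
    hfg.exists_notMem_forall_dvd_mul M (exists_notMem_dvd_mul_or_dvd_mul hmax' hirr' M)⟩
end

section
/- Let R be a φ-ring (a commutative ring whose nilradical Nil(R) is a divided prime ideal). Then R is a φ-Prüfer ring (equivalently, R/Nil(R) is a Prüfer domain) if and only if for every maximal ideal M of R, the quotient R_M/Nil(R_M) of the localization R_M by its nilradical is a valuation domain. -/
section Domain

variable {D : Type*} [CommRing D]

open FractionalIdeal in
/-- An invertible two-generated ideal is principal after inverting an element outside any
given maximal ideal. -/
lemma exists_mul_eq_of_invertible_span_pair {a b : D}
    {J : FractionalIdeal (nonZeroDivisors D) (FractionRing D)}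
    (hJ : (Ideal.span {a, b} : FractionalIdeal (nonZeroDivisors D) (FractionRing D)) * J = 1)
    {m : Ideal D} (hm : m.IsMaximal) :
    ∃ s ∉ m, ∃ c, s * a = c * b ∨ s * b = c * a := by
  let f := algebraMap D (FractionRing D)
  have hf : Function.Injective f := IsFractionRing.injective D (FractionRing D)
  have integral : ∀ x ∈ Ideal.span {a, b}, ∀ y ∈ J, ∃ d, f d = f x * y := fun x hx y hy ↦ by
    rw [← mem_one_iff (nonZeroDivisors D), ← hJ]
    exact mul_mem_mul (mem_coeIdeal_of_mem _ hx) hy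
  have ha : a ∈ Ideal.span {a, b} := Ideal.subset_span (by simp)
  have hb : b ∈ Ideal.span {a, b} := Ideal.subset_span (by simp)
  have key : ∀ z ∈ (Ideal.span {a, b} : FractionalIdeal (nonZeroDivisors D) (FractionRing D)) * J,
      ∃ x ∈ J, ∃ y ∈ J, z = f a * x + f b * y := by
    intro z hz
    refine FractionalIdeal.mul_induction_on hz (fun i hi j hj ↦ ?_) fun z w hz hw ↦ ?_
    · obtain ⟨d, hd, rfl⟩ := (mem_coeIdeal _).1 hi
      obtain ⟨p, q, rfl⟩ := Ideal.mem_span_pair.1 hd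
      refine ⟨p • j, J.val.smul_mem p hj, q • j, J.val.smul_mem q hj, ?_⟩
      simp only [Algebra.smul_def, map_add, map_mul, f]
      ring
    · obtain ⟨x, hx, y, hy, rfl⟩ := hz
      obtain ⟨x', hx', y', hy', rfl⟩ := hw
      exact ⟨x + x', J.val.add_mem hx hx', y + y', J.val.add_mem hy hy', by ring⟩
  obtain ⟨x, hx, y, hy, hxy⟩ := key 1 (hJ ▸ one_mem_one _)
  obtain ⟨ax, hax⟩ := integral a ha x hx
  obtain ⟨bx, hbx⟩ := integral b hb x hx
  obtain ⟨ay, hay⟩ := integral a ha y hy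
  obtain ⟨dy, hdy⟩ := integral b hb y hy
  have hsum : ax + dy = 1 := hf (by rw [map_add, map_one, hax, hdy, hxy])
  by_cases hs : ax ∈ m
  · refine ⟨dy, fun h ↦ hm.ne_top ((Ideal.eq_top_iff_one m).2 (hsum ▸ m.add_mem hs h)), ay,
      Or.inl (hf ?_)⟩
    rw [map_mul, map_mul, hdy, hay]
    ring
  · refine ⟨ax, hs, bx, Or.inr (hf ?_)⟩
    rw [map_mul, map_mul, hax, hbx]
    ring

/-- If any two elements become comparable under divisibility outside the prime `m`, then every
finitely generated ideal becomes principal after inverting some element outside `m`. -/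
lemma Ideal.FG.exists_mul_eq_mul {A : Type*} [CommRing A] {m : Ideal A} (hm : m.IsPrime)
    (h : ∀ a b : A, ∃ s ∉ m, ∃ c, s * a = c * b ∨ s * b = c * a) {I : Ideal A} (hI : I.FG) :
    ∃ g ∈ I, ∃ s ∉ m, ∀ x ∈ I, ∃ c, s * x = c * g := by
  induction I, hI using Submodule.fg_induction with
  | singleton g =>
    refine ⟨g, Submodule.mem_span_singleton_self g, 1, hm.one_notMem, fun x hx ↦ ?_⟩
    obtain ⟨c, rfl⟩ := Submodule.mem_span_singleton.1 hx
    exact ⟨c, by simp⟩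
  | sup I₁ I₂ _ _ h₁ h₂ =>
    obtain ⟨g₁, hg₁, s₁, hs₁, H₁⟩ := h₁
    obtain ⟨g₂, hg₂, s₂, hs₂, H₂⟩ := h₂
    obtain ⟨s, hs, c, hc⟩ := h g₁ g₂
    have hsm : s * (s₁ * s₂) ∉ m := hm.mul_notMem hs (hm.mul_notMem hs₁ hs₂)
    rcases hc with hc | hc
    · refine ⟨g₂, Submodule.mem_sup_right hg₂, _, hsm, fun x hx ↦ ?_⟩
      obtain ⟨x₁, hx₁, x₂, hx₂, rfl⟩ := Submodule.mem_sup.1 hx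
      obtain ⟨c₁, hc₁⟩ := H₁ x₁ hx₁
      obtain ⟨c₂, hc₂⟩ := H₂ x₂ hx₂
      refine ⟨s₂ * c₁ * c + s * s₁ * c₂, ?_⟩
      linear_combination s * s₂ * hc₁ + s * s₁ * hc₂ + s₂ * c₁ * hc
    · refine ⟨g₁, Submodule.mem_sup_left hg₁, _, hsm, fun x hx ↦ ?_⟩
      obtain ⟨x₁, hx₁, x₂, hx₂, rfl⟩ := Submodule.mem_sup.1 hx
      obtain ⟨c₁, hc₁⟩ := H₁ x₁ hx₁
      obtain ⟨c₂, hc₂⟩ := H₂ x₂ hx₂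
      refine ⟨s * s₂ * c₁ + s₁ * c₂ * c, ?_⟩
      linear_combination s * s₂ * hc₁ + s * s₁ * hc₂ + s₁ * c₂ * hc

variable [IsDomain D]

open FractionalIdeal in
/-- A nonzero ideal of a domain is invertible if it is locally principal. -/
lemma mul_inv_eq_one_of_locally_principal {I : Ideal D} (hI : I ≠ ⊥)
    (h : ∀ m : Ideal D, m.IsMaximal → ∃ g ∈ I, ∃ s ∉ m, ∀ x ∈ I, ∃ c, s * x = c * g) :
    (I : FractionalIdeal (nonZeroDivisors D) (FractionRing D)) *
      (I : FractionalIdeal (nonZeroDivisors D) (FractionRing D))⁻¹ = 1 := by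
  have hI' : (I : FractionalIdeal (nonZeroDivisors D) (FractionRing D)) ≠ 0 :=
    coeIdeal_ne_zero.2 hI
  obtain ⟨T, hT⟩ := le_one_iff_exists_coeIdeal.1
    (mul_one_div_le_one (I := (I : FractionalIdeal (nonZeroDivisors D) (FractionRing D))))
  rw [inv_eq, ← hT]
  suffices T = ⊤ by rw [this, coeIdeal_top]
  by_contra hne
  obtain ⟨m, hm, hTm⟩ := Ideal.exists_le_maximal T hne
  obtain ⟨g, hg, s, hs, H⟩ := h m hm
  have hs0 : s ≠ 0 := fun h0 ↦ hs (h0 ▸ m.zero_mem)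
  have hg0 : g ≠ 0 := by
    rintro rfl
    obtain ⟨x, hx, hx0⟩ := Submodule.exists_mem_ne_zero_of_ne_bot hI
    obtain ⟨c, hc⟩ := H x hx
    simp_all
  let f := algebraMap D (FractionRing D)
  have hfg : f g ≠ 0 := by
    simpa [f] using hg0
  have hinv : f s / f g ∈ (I : FractionalIdeal (nonZeroDivisors D) (FractionRing D))⁻¹ := by
    rw [mem_inv_iff hI']
    intro y hy
    obtain ⟨x, hx, rfl⟩ := (mem_coeIdeal _).1 hy
    obtain ⟨c, hc⟩ := H x hx
    refine (mem_one_iff _).2 ⟨c, ?_⟩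
    have hfc : f s * f x = f c * f g := by rw [← map_mul, hc, map_mul]
    change f c = f s / f g * f x
    rw [div_mul_eq_mul_div, hfc, mul_div_cancel_right₀ _ hfg]
  have hsT : f s ∈ (T : FractionalIdeal (nonZeroDivisors D) (FractionRing D)) := by
    rw [hT, ← inv_eq, ← mul_div_cancel₀ (f s) hfg]
    exact mul_mem_mul (mem_coeIdeal_of_mem _ hg) hinv
  obtain ⟨t, ht, hts⟩ := (mem_coeIdeal _).1 hsT
  exact hs (hTm (IsFractionRing.injective D (FractionRing D) hts ▸ ht))

/-- A domain is Prüfer if and only if its localizations at maximal ideals are valuation domains,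
the latter being expressed by elements of the domain itself. -/
lemma forall_invertible_iff_forall_maximal :
    (∀ I : Ideal D, I ≠ ⊥ → I.FG → ∃ J : FractionalIdeal (nonZeroDivisors D) (FractionRing D),
      (I : FractionalIdeal (nonZeroDivisors D) (FractionRing D)) * J = 1) ↔
    ∀ m : Ideal D, m.IsMaximal → ∀ a b : D, ∃ s ∉ m, ∃ c, s * a = c * b ∨ s * b = c * a := by
  refine ⟨fun h m hm a b ↦ ?_, fun h I hI hfg ↦ ⟨_, mul_inv_eq_one_of_locally_principal hI
    fun m hm ↦ hfg.exists_mul_eq_mul hm.isPrime (h m hm)⟩⟩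
  by_cases h0 : Ideal.span {a, b} = ⊥
  · obtain ⟨rfl, rfl⟩ : a = 0 ∧ b = 0 := by simpa [Ideal.span_eq_bot] using h0
    exact ⟨1, hm.isPrime.one_notMem, 0, by simp⟩
  · obtain ⟨J, hJ⟩ := h _ h0 (Submodule.fg_span (Set.toFinite _))
    exact exists_mul_eq_of_invertible_span_pair hJ hm

end Domain

section Localization

variable {R : Type*} [CommRing R]

lemma mk'_mem_nilradical_iff (hN : (nilradical R).IsPrime) (M : Ideal R) [M.IsPrime]
    (a : R) (s : M.primeCompl) :
    IsLocalization.mk' (Localization.AtPrime M) a s ∈ nilradical (Localization.AtPrime M) ↔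
      a ∈ nilradical R := by
  refine ⟨fun h ↦ ?_, fun h ↦ ?_⟩
  · obtain ⟨n, hn⟩ := h
    rw [← IsLocalization.mk'_pow, Ideal.zero_eq_bot, Ideal.mem_bot,
      IsLocalization.mk'_eq_zero_iff] at hn
    obtain ⟨t, ht⟩ := hn
    have htN : (t : R) ∉ nilradical R := fun h ↦ t.2 (nilradical_le_prime M h)
    exact hN.mem_of_pow_mem n
      ((hN.mem_or_mem (ht ▸ (nilradical R).zero_mem)).resolve_left htN)
  · obtain ⟨n, hn⟩ := h
    rw [Ideal.zero_eq_bot, Ideal.mem_bot] at hn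
    refine ⟨n, ?_⟩
    rw [← IsLocalization.mk'_pow, hn, IsLocalization.mk'_zero]
    exact Ideal.zero_mem _

lemma isPrime_nilradical_localization (hN : (nilradical R).IsPrime) (M : Ideal R) [M.IsPrime] :
    (nilradical (Localization.AtPrime M)).IsPrime := by
  refine ⟨fun h ↦ ?_, fun {x y} hxy ↦ ?_⟩
  · have h1 : (1 : Localization.AtPrime M) ∈ nilradical _ := h ▸ Submodule.mem_top
    exact not_isNilpotent_one h1
  · obtain ⟨a, s, rfl⟩ := IsLocalization.exists_mk'_eq M.primeCompl x
    obtain ⟨b, t, rfl⟩ := IsLocalization.exists_mk'_eq M.primeCompl y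
    rw [← IsLocalization.mk'_mul, mk'_mem_nilradical_iff hN] at hxy
    simpa only [mk'_mem_nilradical_iff hN] using hN.mem_or_mem hxy

/-- Divisibility in `R_M / Nil(R_M)`, expressed in `R`. -/
lemma mk_mk'_dvd_mk_mk'_iff (hN : (nilradical R).IsPrime) (M : Ideal R) [M.IsPrime]
    (a b : R) (s t : M.primeCompl) :
    Ideal.Quotient.mk (nilradical (Localization.AtPrime M)) (IsLocalization.mk' _ a s) ∣
        Ideal.Quotient.mk (nilradical (Localization.AtPrime M)) (IsLocalization.mk' _ b t) ↔
      ∃ u ∉ M, ∃ c, u * b - c * a ∈ nilradical R := by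
  have mk'_sub (c : R) (u : M.primeCompl) : IsLocalization.mk' (Localization.AtPrime M) b t -
      IsLocalization.mk' _ a s * IsLocalization.mk' _ c u =
        IsLocalization.mk' _ ((s * u : M.primeCompl) * b - (t * c) * a) (t * (s * u)) := by
    rw [← IsLocalization.mk'_mul, ← IsLocalization.mk'_sub]
    congr 1
    push_cast
    ring
  constructor
  · rintro ⟨z, hz⟩
    obtain ⟨z, rfl⟩ := Ideal.Quotient.mk_surjective z
    obtain ⟨c, u, rfl⟩ := IsLocalization.exists_mk'_eq M.primeCompl z
    rw [← map_mul, Ideal.Quotient.eq, mk'_sub, mk'_mem_nilradical_iff hN] at hz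
    exact ⟨_, (s * u).2, _, hz⟩
  · rintro ⟨u, hu, c, hc⟩
    refine ⟨Ideal.Quotient.mk _ (IsLocalization.mk' _ (s * c) (t * ⟨u, hu⟩ : M.primeCompl)), ?_⟩
    rw [← map_mul, Ideal.Quotient.eq, mk'_sub, mk'_mem_nilradical_iff hN]
    convert Ideal.mul_mem_left _ (s * t : R) hc using 1
    push_cast
    ring

end Localization

theorem phiPrufer_iff_localizations_valuation (R : Type*) [CommRing R]
    (hR : IsPhiRing R) :
    IsPhiPrufer R ↔
      ∀ (M : Ideal R) (hM : M.IsMaximal),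
        haveI := hM.isPrime
        IsDomain (Localization.AtPrime M ⧸ nilradical (Localization.AtPrime M)) ∧
          ∀ a b : Localization.AtPrime M ⧸ nilradical (Localization.AtPrime M),
            a ∣ b ∨ b ∣ a := by
  have hN := hR.1
  have hD : IsDomain (R ⧸ nilradical R) := Ideal.Quotient.isDomain _
  have hmk := Ideal.Quotient.mk_surjective (I := nilradical R)
  rw [IsPhiPrufer, forall_invertible_iff_forall_maximal]
  constructor
  · intro h M hM
    have hMp := hM.isPrime
    have := isPrime_nilradical_localization hN M
    refine ⟨Ideal.Quotient.isDomain _, fun x y ↦ ?_⟩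
    obtain ⟨x, rfl⟩ := Ideal.Quotient.mk_surjective x
    obtain ⟨y, rfl⟩ := Ideal.Quotient.mk_surjective y
    obtain ⟨a, s, rfl⟩ := IsLocalization.exists_mk'_eq M.primeCompl x
    obtain ⟨b, t, rfl⟩ := IsLocalization.exists_mk'_eq M.primeCompl y
    have hker : RingHom.ker (Ideal.Quotient.mk (nilradical R)) ≤ M := by
      rw [Ideal.mk_ker]
      exact nilradical_le_prime M
    obtain ⟨u, hu, c, hc⟩ := h _ (hM.map_of_surjective_of_ker_le hmk hker)
      (Ideal.Quotient.mk _ a) (Ideal.Quotient.mk _ b)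
    obtain ⟨u, rfl⟩ := hmk u
    obtain ⟨c, rfl⟩ := hmk c
    have hu' : u ∉ M := fun h ↦ hu (Ideal.mem_map_of_mem _ h)
    simp only [← map_mul, Ideal.Quotient.eq] at hc
    rw [mk_mk'_dvd_mk_mk'_iff hN, mk_mk'_dvd_mk_mk'_iff hN]
    exact hc.symm.imp (fun h ↦ ⟨u, hu', c, h⟩) fun h ↦ ⟨u, hu', c, h⟩
  · intro h m hm x y
    obtain ⟨a, rfl⟩ := hmk x
    obtain ⟨b, rfl⟩ := hmk y
    have hM : (m.comap (Ideal.Quotient.mk (nilradical R))).IsMaximal :=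
      Ideal.comap_isMaximal_of_surjective _ hmk
    have hMp := hM.isPrime
    let one : (m.comap (Ideal.Quotient.mk (nilradical R))).primeCompl := 1
    have hab := (h _ hM).2 (Ideal.Quotient.mk _ (IsLocalization.mk' _ a one))
      (Ideal.Quotient.mk _ (IsLocalization.mk' _ b one))
    rw [mk_mk'_dvd_mk_mk'_iff hN, mk_mk'_dvd_mk_mk'_iff hN] at hab
    rcases hab with ⟨u, hu, c, hc⟩ | ⟨u, hu, c, hc⟩ <;>
      refine ⟨Ideal.Quotient.mk _ u, hu, Ideal.Quotient.mk _ c, ?_⟩ <;>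
      simp only [← map_mul, Ideal.Quotient.eq, hc, true_or, or_true]
end

section
/- Let K be a field and let R = K[x, y]/(x², y²). Then: (a) the nilradical of R is a divided prime ideal (so R is a φ-ring) and R/Nil(R) is isomorphic to K, so R is a φ-Prüfer ring; but (b) R is not a Gaussian ring: for the images x̄, ȳ of x, y in R, the polynomials f = x̄Z + ȳ and g = x̄Z − ȳ in R[Z] satisfy fg = 0, while c(f)·c(g) = (x̄, ȳ)² = (x̄ȳ) ≠ (0), so c(fg) ≠ c(f)c(g). -/
/-- The ring `K[x, y] ⧸ (x², y²)`. -/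
noncomputable def ExRing (K : Type*) [Field K] : Type _ :=
  MvPolynomial (Fin 2) K ⧸
    Ideal.span ({MvPolynomial.X 0 ^ 2, MvPolynomial.X 1 ^ 2} : Set (MvPolynomial (Fin 2) K))

noncomputable instance (K : Type*) [Field K] : CommRing (ExRing K) :=
  Ideal.Quotient.commRing _

/-- The image of `x` in `K[x, y] ⧸ (x², y²)`. -/
noncomputable def exX (K : Type*) [Field K] : ExRing K :=
  Ideal.Quotient.mk _ (MvPolynomial.X 0)

/-- The image of `y` in `K[x, y] ⧸ (x², y²)`. -/
noncomputable def exY (K : Type*) [Field K] : ExRing K :=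
  Ideal.Quotient.mk _ (MvPolynomial.X 1)

namespace ExRing

variable (K : Type*) [Field K]

theorem exX_sq : exX K ^ 2 = 0 :=
  Ideal.Quotient.eq_zero_iff_mem.mpr (Ideal.subset_span (by simp))

theorem exY_sq : exY K ^ 2 = 0 :=
  Ideal.Quotient.eq_zero_iff_mem.mpr (Ideal.subset_span (by simp))

/-- The quotient map `K[x, y] → K[x, y] ⧸ (x², y²)`. -/
noncomputable def proj : MvPolynomial (Fin 2) K →+* ExRing K :=
  Ideal.Quotient.mk _

theorem proj_surjective : Function.Surjective (proj K) :=
  Ideal.Quotient.mk_surjective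

variable {K} in
/-- The ring homomorphism out of `K[x, y] ⧸ (x², y²)` determined by two elements of square zero. -/
noncomputable def lift {S : Type*} [CommRing S] (φ : K →+* S) (v : Fin 2 → S)
    (hv : ∀ i, v i ^ 2 = 0) : ExRing K →+* S :=
  Ideal.Quotient.lift _ (MvPolynomial.eval₂Hom φ v) fun a ha => by
    have hle : Ideal.span ({MvPolynomial.X 0 ^ 2, MvPolynomial.X 1 ^ 2} :
        Set (MvPolynomial (Fin 2) K)) ≤ RingHom.ker (MvPolynomial.eval₂Hom φ v) := by
      rw [Ideal.span_le]
      rintro p (rfl | rfl) <;> simp [RingHom.mem_ker, hv]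
    exact hle ha

variable {K} in
theorem lift_proj {S : Type*} [CommRing S] (φ : K →+* S) (v : Fin 2 → S)
    (hv : ∀ i, v i ^ 2 = 0) (p : MvPolynomial (Fin 2) K) :
    lift φ v hv (proj K p) = MvPolynomial.eval₂Hom φ v p :=
  Ideal.Quotient.lift_mk _ _ _

theorem exX_mul_exY_ne_zero : exX K * exY K ≠ 0 := by
  intro h
  let v : Fin 2 → DualNumber (DualNumber K) :=
    ![TrivSqZeroExt.inl DualNumber.eps, DualNumber.eps]
  have hv : ∀ i, v i ^ 2 = 0 := by
    intro i
    fin_cases i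
    · simp [v, sq, ← TrivSqZeroExt.inl_mul]
    · simp [v, sq]
  have h' := congrArg (lift (algebraMap K (DualNumber (DualNumber K))) v hv) h
  have hX : exX K = proj K (MvPolynomial.X 0) := rfl
  have hY : exY K = proj K (MvPolynomial.X 1) := rfl
  rw [map_mul, hX, hY, lift_proj, lift_proj, map_zero] at h'
  have h₂ := congrArg (fun z => TrivSqZeroExt.snd (TrivSqZeroExt.snd z)) h'
  simp [v] at h₂

/-- The augmentation `K[x, y] ⧸ (x², y²) → K`. -/
noncomputable def augmentation : ExRing K →+* K :=
  lift (RingHom.id K) 0 (by simp)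

theorem augmentation_surjective : Function.Surjective (augmentation K) := fun a =>
  ⟨proj K (MvPolynomial.C a), by simp [augmentation, lift_proj]⟩

theorem ker_augmentation : RingHom.ker (augmentation K) = nilradical (ExRing K) := by
  apply le_antisymm
  · have hcomp : (Ideal.Quotient.mk (nilradical (ExRing K))).comp (proj K) =
        (((Ideal.Quotient.mk (nilradical (ExRing K))).comp (proj K)).comp MvPolynomial.C).comp
          ((augmentation K).comp (proj K)) := by
      apply MvPolynomial.ringHom_ext
      · intro a
        simp [augmentation, lift_proj]
      · intro i
        have hi : proj K (MvPolynomial.X i) ∈ nilradical (ExRing K) := by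
          refine mem_nilradical.mpr ⟨2, ?_⟩
          fin_cases i
          · exact exX_sq K
          · exact exY_sq K
        simp [augmentation, lift_proj, Ideal.Quotient.eq_zero_iff_mem.mpr hi]
    intro r hr
    obtain ⟨p, rfl⟩ := proj_surjective K r
    have h := RingHom.congr_fun hcomp p
    simp only [RingHom.comp_apply, (RingHom.mem_ker).mp hr, map_zero] at h
    exact Ideal.Quotient.eq_zero_iff_mem.mp h
  · intro r hr
    exact RingHom.mem_ker.mpr (((mem_nilradical.mp hr).map (augmentation K)).eq_zero)

instance nilradical_isMaximal : (nilradical (ExRing K)).IsMaximal := by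
  rw [← ker_augmentation]
  exact RingHom.ker_isMaximal_of_surjective _ (augmentation_surjective K)

end ExRing

theorem isPhiRing_of_nilradical_isMaximal (R : Type*) [CommRing R]
    [h : (nilradical R).IsMaximal] : IsPhiRing R := by
  refine ⟨h.isPrime, fun I => ?_⟩
  by_cases hI : I = ⊤
  · exact Or.inr (hI ▸ le_top)
  · obtain ⟨M, hM, hIM⟩ := Ideal.exists_le_maximal I hI
    have hMn : nilradical R = M :=
      h.eq_of_le hM.ne_top (have := hM.isPrime; nilradical_le_prime M)
    exact Or.inl (hMn ▸ hIM)

theorem isPhiPrufer_of_nilradical_isMaximal (R : Type*) [CommRing R]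
    [h : (nilradical R).IsMaximal] : IsPhiPrufer R := by
  intro I hI _
  have hI' : I = ⊤ := by
    let := Ideal.Quotient.field (nilradical R)
    exact (Ideal.eq_bot_or_top I).resolve_left hI
  exact ⟨1, by simp [hI']⟩

theorem contentIdeal_C_mul_X_add_C {R : Type*} [CommRing R] (a b : R) :
    contentIdeal (Polynomial.C a * Polynomial.X + Polynomial.C b) = Ideal.span {a, b} := by
  apply le_antisymm
  · refine Ideal.span_le.mpr ?_
    rintro _ ⟨n, rfl⟩
    rcases n with _ | _ | n
    · simpa using Ideal.subset_span (by simp)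
    · simpa [Polynomial.coeff_C] using Ideal.subset_span (by simp)
    · simp
  · refine Ideal.span_le.mpr ?_
    rintro _ (rfl | rfl)
    · exact Ideal.subset_span ⟨1, by simp [Polynomial.coeff_C]⟩
    · exact Ideal.subset_span ⟨0, by simp⟩

theorem contentIdeal_zero {R : Type*} [CommRing R] :
    contentIdeal (0 : Polynomial R) = ⊥ := by
  refine Ideal.span_eq_bot.mpr ?_
  rintro _ ⟨n, rfl⟩
  simp

theorem span_pair_mul_span_pair_neg {R : Type*} [CommRing R] {a b : R}
    (ha : a ^ 2 = 0) (hb : b ^ 2 = 0) :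
    Ideal.span {a, b} * Ideal.span {a, -b} = Ideal.span {a * b} := by
  rw [Ideal.span_pair_mul_span_pair]
  have h₁ : a * a = 0 := by rw [← sq, ha]
  have h₂ : b * -b = 0 := by rw [mul_neg, ← sq, hb, neg_zero]
  rw [h₁, h₂]
  apply le_antisymm
  · refine Ideal.span_le.mpr ?_
    rintro _ (rfl | rfl | rfl | rfl)
    · exact zero_mem _
    · simp
    · simp [mul_comm]
    · exact zero_mem _
  · refine (Ideal.span_singleton_le_iff_mem _).mpr (Ideal.subset_span ?_)
    simp [mul_comm]

theorem exRing_phiPrufer_not_gaussian (K : Type*) [Field K] :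
    -- (a) R = K[x,y]/(x²,y²) is a φ-ring, R/Nil(R) ≅ K, and R is φ-Prüfer
    IsPhiRing (ExRing K) ∧
      Nonempty ((ExRing K ⧸ nilradical (ExRing K)) ≃+* K) ∧
      IsPhiPrufer (ExRing K) ∧
      -- (b) R is not Gaussian, as witnessed by f = x̄ Z + ȳ and g = x̄ Z - ȳ:
      ((Polynomial.C (exX K) * Polynomial.X + Polynomial.C (exY K)) *
          (Polynomial.C (exX K) * Polynomial.X - Polynomial.C (exY K)) = 0 ∧
        contentIdeal (Polynomial.C (exX K) * Polynomial.X + Polynomial.C (exY K)) *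
            contentIdeal (Polynomial.C (exX K) * Polynomial.X - Polynomial.C (exY K)) =
          Ideal.span {exX K * exY K} ∧
        Ideal.span ({exX K * exY K} : Set (ExRing K)) ≠ ⊥ ∧
        contentIdeal ((Polynomial.C (exX K) * Polynomial.X + Polynomial.C (exY K)) *
            (Polynomial.C (exX K) * Polynomial.X - Polynomial.C (exY K))) ≠
          contentIdeal (Polynomial.C (exX K) * Polynomial.X + Polynomial.C (exY K)) *
            contentIdeal (Polynomial.C (exX K) * Polynomial.X - Polynomial.C (exY K))) := by
  have hfg : (Polynomial.C (exX K) * Polynomial.X + Polynomial.C (exY K)) *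
      (Polynomial.C (exX K) * Polynomial.X - Polynomial.C (exY K)) = 0 := by
    have hx : Polynomial.C (exX K) ^ 2 = 0 := by rw [← map_pow, ExRing.exX_sq, map_zero]
    have hy : Polynomial.C (exY K) ^ 2 = 0 := by rw [← map_pow, ExRing.exY_sq, map_zero]
    linear_combination Polynomial.X ^ 2 * hx - hy
  have hc : contentIdeal (Polynomial.C (exX K) * Polynomial.X + Polynomial.C (exY K)) *
      contentIdeal (Polynomial.C (exX K) * Polynomial.X - Polynomial.C (exY K)) =
        Ideal.span {exX K * exY K} := by
    rw [sub_eq_add_neg, ← map_neg, contentIdeal_C_mul_X_add_C, contentIdeal_C_mul_X_add_C,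
      span_pair_mul_span_pair_neg (ExRing.exX_sq K) (ExRing.exY_sq K)]
  have hne : Ideal.span ({exX K * exY K} : Set (ExRing K)) ≠ ⊥ := fun h =>
    ExRing.exX_mul_exY_ne_zero K (Ideal.span_singleton_eq_bot.mp h)
  refine ⟨isPhiRing_of_nilradical_isMaximal _,
    ⟨(Ideal.quotEquivOfEq (ExRing.ker_augmentation K).symm).trans
      (RingHom.quotientKerEquivOfSurjective (ExRing.augmentation_surjective K))⟩,
    isPhiPrufer_of_nilradical_isMaximal _, hfg, hc, hne, ?_⟩
  rw [hc, hfg, contentIdeal_zero]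
  exact hne.symm
end
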